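/- Fix g ≥ 1 and let Γ = ⟨a_1,…,a_{g+1} ∣ a_1²a_2²⋯a_{g+1}²⟩ be the presented group on g+1 generators with the single relator ∏_{i=1}^{g+1} a_i² (the fundamental group of the closed non-orientable surface of genus g). Then Γ is weakly ucp stable: for every finite subset S ⊆ Γ and every ε > 0 there exist a finite subset T ⊆ Γ and δ > 0 such that for every n ≥ 1 and every ucp (T,δ)-representation φ : Γ → M_n(ℂ) there exist k ∈ ℕ, a unitary representation θ : Γ → M_k(ℂ), and a unitary representation π : Γ → M_{n+k}(ℂ) such that ‖(φ(s) ⊕ θ(s)) − π(s)‖ < ε for all s ∈ S. -/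

import Mathlib

open scoped Matrix.Norms.L2Operator ComplexOrder

noncomputable section

/-- The relator `∏_{i=1}^{g+1} a_i²` in the free group on `g+1` generators. -/
def nonorientableRelator (g : ℕ) : FreeGroup (Fin (g + 1)) :=
  (List.ofFn fun i : Fin (g + 1) => FreeGroup.of i * FreeGroup.of i).prod

/-- The fundamental group of the closed non-orientable surface of genus `g`. -/
abbrev NonorientableSurfaceGroup (g : ℕ) : Type :=
  PresentedGroup ({nonorientableRelator g} : Set (FreeGroup (Fin (g + 1))))

/-- A `(T,δ)`-representation of `Γ` on `M_n(ℂ)` (operator norm): a unital map into the closed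
unit ball that is `δ`-multiplicative on `T`. -/
def IsQuasiRep {Γ : Type*} [Group Γ] (T : Set Γ) (δ : ℝ) {n : ℕ}
    (φ : Γ → Matrix (Fin n) (Fin n) ℂ) : Prop :=
  φ 1 = 1 ∧ (∀ x, ‖φ x‖ ≤ 1) ∧ ∀ s ∈ T, ∀ t ∈ T, ‖φ s * φ t - φ (s * t)‖ < δ

/-- A map `φ : Γ → M_n(ℂ)` is unital completely positive if all matrices
`∑_{g,h∈F} conj (z g) * z h • φ (g⁻¹ h)` are positive semidefinite. -/
def IsUcpQuasiRep {Γ : Type*} [Group Γ] {n : ℕ} (φ : Γ → Matrix (Fin n) (Fin n) ℂ) : Prop :=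
  ∀ (F : Finset Γ) (z : Γ → ℂ),
    (∑ g ∈ F, ∑ h ∈ F, ((starRingEnd ℂ) (z g) * z h) • φ (g⁻¹ * h)).PosSemidef

/-- A unitary representation of `Γ` on `M_k(ℂ)`. -/
def IsUnitaryRep {Γ : Type*} [Group Γ] {k : ℕ} (θ : Γ → Matrix (Fin k) (Fin k) ℂ) : Prop :=
  θ 1 = 1 ∧ (∀ x y, θ (x * y) = θ x * θ y) ∧
    ∀ x, θ x ∈ unitary (Matrix (Fin k) (Fin k) ℂ)

/-- Block sum of square matrices. -/
def blockSum {n k : ℕ} (x : Matrix (Fin n) (Fin n) ℂ) (y : Matrix (Fin k) (Fin k) ℂ) :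
    Matrix (Fin (n + k)) (Fin (n + k)) ℂ :=
  Matrix.reindex finSumFinEquiv finSumFinEquiv (Matrix.fromBlocks x 0 0 y)

section

open Matrix

section Norms

set_option linter.unusedSectionVars false

variable {m n l p q : Type*} [Fintype m] [Fintype n] [Fintype l] [Fintype p] [Fintype q]
  [DecidableEq m] [DecidableEq n] [DecidableEq l] [DecidableEq p] [DecidableEq q]

lemma norm_one_le : ‖(1 : Matrix n n ℂ)‖ ≤ 1 := by
  have := Matrix.l2_opNorm_diagonal (𝕜 := ℂ) (fun _ : n => (1 : ℂ))
  rw [← Matrix.diagonal_one, this]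
  exact (pi_norm_le_iff_of_nonneg zero_le_one).2 fun i => by simp

lemma norm_le_one_of_isometry {V : Matrix m n ℂ} (hV : Vᴴ * V = 1) : ‖V‖ ≤ 1 := by
  have h := Matrix.l2_opNorm_conjTranspose_mul_self V
  rw [hV] at h
  have := norm_one_le (n := n)
  nlinarith [norm_nonneg V]

lemma norm_le_one_of_mem_unitary {U : Matrix n n ℂ} (hU : U ∈ unitary (Matrix n n ℂ)) :
    ‖U‖ ≤ 1 :=
  norm_le_one_of_isometry (Unitary.star_mul_self_of_mem hU)

lemma norm_isometry_mul {V : Matrix m n ℂ} (hV : Vᴴ * V = 1) (A : Matrix n l ℂ) :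
    ‖V * A‖ = ‖A‖ := by
  have h1 := Matrix.l2_opNorm_conjTranspose_mul_self (V * A)
  have h2 := Matrix.l2_opNorm_conjTranspose_mul_self A
  rw [conjTranspose_mul, Matrix.mul_assoc, ← Matrix.mul_assoc Vᴴ, hV, Matrix.one_mul, h2] at h1
  nlinarith [norm_nonneg (V * A), norm_nonneg A, sq_nonneg (‖V * A‖ - ‖A‖)]

lemma norm_mul_coisometry {V : Matrix l n ℂ} (hV : V * Vᴴ = 1) (A : Matrix m l ℂ) :
    ‖A * V‖ = ‖A‖ := by
  rw [← Matrix.l2_opNorm_conjTranspose (A * V), conjTranspose_mul,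
    norm_isometry_mul (by rwa [conjTranspose_conjTranspose]), Matrix.l2_opNorm_conjTranspose]

lemma norm_unitary_mul {U : Matrix n n ℂ} (hU : U ∈ unitary (Matrix n n ℂ)) (A : Matrix n l ℂ) :
    ‖U * A‖ = ‖A‖ :=
  norm_isometry_mul (Unitary.star_mul_self_of_mem hU) A

lemma norm_mul_unitary {U : Matrix n n ℂ} (hU : U ∈ unitary (Matrix n n ℂ)) (A : Matrix m n ℂ) :
    ‖A * U‖ = ‖A‖ :=
  norm_mul_coisometry (Unitary.mul_star_self_of_mem hU) A

lemma mem_unitary_of_conjTranspose_mul {U : Matrix n n ℂ} (h : Uᴴ * U = 1) :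
    U ∈ unitary (Matrix n n ℂ) :=
  Unitary.mem_iff.2 ⟨h, mul_eq_one_comm.1 h⟩

lemma norm_sub_conjTranspose (A B : Matrix m n ℂ) : ‖Aᴴ - Bᴴ‖ = ‖A - B‖ := by
  rw [← conjTranspose_sub, Matrix.l2_opNorm_conjTranspose]

/-- Block diagonal sum of two square matrices, as a star homomorphism. -/
def dsumHom (m n : Type*) [Fintype m] [Fintype n] [DecidableEq m] [DecidableEq n] :
    (Matrix m m ℂ × Matrix n n ℂ) →⋆ₐ[ℂ] Matrix (m ⊕ n) (m ⊕ n) ℂ where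
  toFun x := fromBlocks x.1 0 0 x.2
  map_one' := by simp
  map_mul' x y := by simp [fromBlocks_multiply]
  map_zero' := by simp
  map_add' x y := by simp [fromBlocks_add]
  commutes' r := by
    ext (i | i) (j | j) <;> simp [algebraMap_eq_diagonal, diagonal_apply]
  map_star' x := by simp [star_eq_conjTranspose, fromBlocks_conjTranspose]

/-- Block diagonal sum of two square matrices. -/
def dsum (A : Matrix m m ℂ) (B : Matrix n n ℂ) : Matrix (m ⊕ n) (m ⊕ n) ℂ := fromBlocks A 0 0 B

lemma dsumHom_apply (A : Matrix m m ℂ) (B : Matrix n n ℂ) : dsumHom m n (A, B) = dsum A B := rfl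

lemma norm_dsum (A : Matrix m m ℂ) (B : Matrix n n ℂ) : ‖dsum A B‖ = max ‖A‖ ‖B‖ := by
  have hinj : Function.Injective (dsumHom m n) := by
    rintro ⟨a, b⟩ ⟨c, d⟩ h
    rw [dsumHom_apply, dsumHom_apply, dsum, dsum, fromBlocks_inj] at h
    simp [h.1, h.2.2.2]
  rw [← dsumHom_apply, NonUnitalStarAlgHom.norm_map _ hinj, Prod.norm_def]

lemma dsum_sub (A A' : Matrix m m ℂ) (B B' : Matrix n n ℂ) :
    dsum A B - dsum A' B' = dsum (A - A') (B - B') :=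
  (map_sub (dsumHom m n) (A, B) (A', B')).symm

lemma dsum_mul (A A' : Matrix m m ℂ) (B B' : Matrix n n ℂ) :
    dsum A B * dsum A' B' = dsum (A * A') (B * B') :=
  (map_mul (dsumHom m n) (A, B) (A', B')).symm

lemma dsum_one : dsum (1 : Matrix m m ℂ) (1 : Matrix n n ℂ) = 1 := map_one (dsumHom m n)

lemma conjTranspose_dsum (A : Matrix m m ℂ) (B : Matrix n n ℂ) :
    (dsum A B)ᴴ = dsum Aᴴ Bᴴ :=
  (map_star (dsumHom m n) (A, B)).symm

lemma dsum_mem_unitary {A : Matrix m m ℂ} {B : Matrix n n ℂ}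
    (hA : A ∈ unitary (Matrix m m ℂ)) (hB : B ∈ unitary (Matrix n n ℂ)) :
    dsum A B ∈ unitary (Matrix (m ⊕ n) (m ⊕ n) ℂ) := by
  apply mem_unitary_of_conjTranspose_mul
  rw [conjTranspose_dsum, dsum_mul, ← star_eq_conjTranspose, ← star_eq_conjTranspose,
    Unitary.star_mul_self_of_mem hA, Unitary.star_mul_self_of_mem hB, dsum_one]

/-- Reindexing of square matrices, as a star homomorphism. -/
def reindexHom (e : m ≃ n) : Matrix n n ℂ →⋆ₐ[ℂ] Matrix m m ℂ where
  toFun A := A.submatrix e e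
  map_one' := by simp
  map_mul' x y := by simp [submatrix_mul_equiv]
  map_zero' := by simp
  map_add' x y := by simp [submatrix_add]
  commutes' r := by
    ext i j; simp [algebraMap_eq_diagonal, diagonal_apply]
  map_star' x := by simp [star_eq_conjTranspose]

lemma reindexHom_apply (e : m ≃ n) (A : Matrix n n ℂ) : reindexHom e A = A.submatrix e e := rfl

lemma norm_reindexHom (e : m ≃ n) (A : Matrix n n ℂ) : ‖reindexHom e A‖ = ‖A‖ := by
  have hinj : Function.Injective (reindexHom e) := by
    intro A B h
    ext i j
    have := congr_fun (congr_fun h (e.symm i)) (e.symm j)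
    simpa [reindexHom_apply] using this
  exact NonUnitalStarAlgHom.norm_map _ hinj A

lemma map_mem_unitary {A B F : Type*} [Monoid A] [StarMul A] [Monoid B] [StarMul B]
    [FunLike F A B] [MonoidHomClass F A B] [StarHomClass F A B] (f : F) {u : A}
    (hu : u ∈ unitary A) : f u ∈ unitary B := Unitary.map_mem f hu

lemma norm_fromRows_one_zero : ‖(fromRows 1 0 : Matrix (m ⊕ n) m ℂ)‖ ≤ 1 :=
  norm_le_one_of_isometry <| by
    simp [conjTranspose_fromRows_eq_fromCols_conjTranspose, fromCols_mul_fromRows]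

lemma norm_fromRows_zero_one : ‖(fromRows 0 1 : Matrix (m ⊕ n) n ℂ)‖ ≤ 1 :=
  norm_le_one_of_isometry <| by
    simp [conjTranspose_fromRows_eq_fromCols_conjTranspose, fromCols_mul_fromRows]

lemma norm_mul_mul_conjTranspose_le {E : Matrix p m ℂ} {F : Matrix q n ℂ} (hE : ‖E‖ ≤ 1)
    (hF : ‖F‖ ≤ 1) (A : Matrix m n ℂ) : ‖E * A * Fᴴ‖ ≤ ‖A‖ := by
  calc ‖E * A * Fᴴ‖ ≤ ‖E‖ * ‖A‖ * ‖Fᴴ‖ :=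
        (l2_opNorm_mul _ _).trans (by gcongr; exact l2_opNorm_mul _ _)
    _ ≤ 1 * ‖A‖ * 1 := by rw [l2_opNorm_conjTranspose]; gcongr
    _ = ‖A‖ := by ring

lemma norm_fromBlocks_le (A : Matrix m n ℂ) (B : Matrix m l ℂ) (C : Matrix p n ℂ) :
    ‖fromBlocks A B C 0‖ ≤ ‖A‖ + ‖B‖ + ‖C‖ := by
  have h : fromBlocks A B C (0 : Matrix p l ℂ) =
      (fromRows 1 0 : Matrix (m ⊕ p) m ℂ) * A * (fromRows 1 0 : Matrix (n ⊕ l) n ℂ)ᴴ +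
      (fromRows 1 0 : Matrix (m ⊕ p) m ℂ) * B * (fromRows 0 1 : Matrix (n ⊕ l) l ℂ)ᴴ +
      (fromRows 0 1 : Matrix (m ⊕ p) p ℂ) * C * (fromRows 1 0 : Matrix (n ⊕ l) n ℂ)ᴴ := by
    simp only [conjTranspose_fromRows_eq_fromCols_conjTranspose, fromRows_mul]
    ext (i | i) (j | j) <;> simp
  rw [h]
  refine (norm_add₃_le).trans (add_le_add (add_le_add ?_ ?_) ?_)
  · exact norm_mul_mul_conjTranspose_le norm_fromRows_one_zero norm_fromRows_one_zero A
  · exact norm_mul_mul_conjTranspose_le norm_fromRows_one_zero norm_fromRows_zero_one B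
  · exact norm_mul_mul_conjTranspose_le norm_fromRows_zero_one norm_fromRows_one_zero C

end Norms

section Tuples

set_option linter.unusedSectionVars false

variable {m n p q : Type*} [Fintype m] [Fintype n] [Fintype p] [Fintype q]
  [DecidableEq m] [DecidableEq n] [DecidableEq p] [DecidableEq q] {k : ℕ}

/-- The value `∏ uᵢ²` of the relator on a tuple. -/
def sqProd {M : Type*} [Monoid M] (u : Fin k → M) : M := (List.ofFn fun i => u i * u i).prod

lemma map_sqProd {M N F : Type*} [Monoid M] [Monoid N] [FunLike F M N] [MonoidHomClass F M N]
    (f : F) (u : Fin k → M) : f (sqProd u) = sqProd fun i => f (u i) := by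
  simp [sqProd, map_list_prod, List.map_ofFn, Function.comp_def]

lemma sqProd_succ {M : Type*} [Monoid M] (u : Fin (k + 1) → M) :
    sqProd u = u 0 * u 0 * sqProd fun i : Fin k => u i.succ := by
  simp [sqProd, List.ofFn_succ]

lemma sqProd_mem_unitary {A : Type*} [Monoid A] [StarMul A] {u : Fin k → A}
    (hu : ∀ i, u i ∈ unitary A) : sqProd u ∈ unitary A := by
  refine Submonoid.list_prod_mem _ fun x hx => ?_
  obtain ⟨i, rfl⟩ := (List.mem_ofFn' _ _).1 hx
  exact mul_mem (hu i) (hu i)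

/-- A tuple of unitary matrices satisfying the relation `∏ uᵢ² = 1`. -/
def IsFlat (u : Fin k → Matrix n n ℂ) : Prop :=
  (∀ i, u i ∈ unitary (Matrix n n ℂ)) ∧ sqProd u = 1

lemma IsFlat.dsum {u : Fin k → Matrix m m ℂ} {v : Fin k → Matrix n n ℂ} (hu : IsFlat u)
    (hv : IsFlat v) : IsFlat fun i => dsum (u i) (v i) := by
  refine ⟨fun i => dsum_mem_unitary (hu.1 i) (hv.1 i), ?_⟩
  have h := map_sqProd (dsumHom m n) fun i => (u i, v i)
  have h1 := map_sqProd (MonoidHom.fst (Matrix m m ℂ) (Matrix n n ℂ)) fun i => (u i, v i)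
  have h2 := map_sqProd (MonoidHom.snd (Matrix m m ℂ) (Matrix n n ℂ)) fun i => (u i, v i)
  have h3 : (sqProd fun i => (u i, v i)) = 1 :=
    Prod.ext (h1.trans hu.2) (h2.trans hv.2)
  rw [h3, map_one] at h
  exact h.symm

lemma IsFlat.map_reindexHom {u : Fin k → Matrix n n ℂ} (hu : IsFlat u) (e : m ≃ n) :
    IsFlat fun i => reindexHom e (u i) :=
  ⟨fun i => map_mem_unitary _ (hu.1 i), by rw [← map_sqProd, hu.2, map_one]⟩

/-- Conjugation by a unitary rectangular matrix. -/
def conjHom (U : Matrix p q ℂ) (h : Uᴴ * U = 1) (h' : U * Uᴴ = 1) :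
    Matrix p p ℂ →* Matrix q q ℂ where
  toFun X := Uᴴ * X * U
  map_one' := by simp [h]
  map_mul' X Y := by
    calc Uᴴ * (X * Y) * U = Uᴴ * X * (1 : Matrix p p ℂ) * Y * U := by simp [Matrix.mul_assoc]
      _ = _ := by rw [← h']; simp only [Matrix.mul_assoc]

lemma IsFlat.conj {u : Fin k → Matrix p p ℂ} (hu : IsFlat u) {U : Matrix p q ℂ}
    (h : Uᴴ * U = 1) (h' : U * Uᴴ = 1) : IsFlat fun i => Uᴴ * u i * U := by
  refine ⟨fun i => mem_unitary_of_conjTranspose_mul ?_, ?_⟩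
  · calc (Uᴴ * u i * U)ᴴ * (Uᴴ * u i * U)
        = Uᴴ * star (u i) * (U * Uᴴ) * u i * U := by
          simp [conjTranspose_mul, Matrix.mul_assoc, star_eq_conjTranspose]
      _ = Uᴴ * (star (u i) * u i) * U := by rw [h', Matrix.mul_one]; simp only [Matrix.mul_assoc]
      _ = 1 := by rw [Unitary.star_mul_self_of_mem (hu.1 i), Matrix.mul_one, h]
  · have := map_sqProd (conjHom U h h') u
    rw [hu.2, map_one] at this
    exact this.symm

lemma exists_complement_of_isometry {V : Matrix m n ℂ} (hV : Vᴴ * V = 1)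
    {P : Fin k → Matrix m m ℂ} (hP : IsFlat P) {u ρ : Fin k → Matrix n n ℂ} (hρ : IsFlat ρ)
    (hu : ∀ i, u i ∈ unitary (Matrix n n ℂ)) {e : ℝ} (he : ∀ i, ‖P i * V - V * u i‖ ≤ e) :
    ∃ (v : Fin k → Matrix m m ℂ) (Q : Fin k → Matrix (n ⊕ m) (n ⊕ m) ℂ), IsFlat Q ∧
      ∀ i, ‖dsum (u i) (v i) - Q i‖ ≤ 3 * e := by
  set R : Matrix m m ℂ := 1 - V * Vᴴ with hR
  have hRV : R * V = 0 := by rw [hR, Matrix.sub_mul, Matrix.mul_assoc, hV]; simp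
  have hVR : Vᴴ * R = 0 := by rw [hR, Matrix.mul_sub, ← Matrix.mul_assoc, hV]; simp
  have hRR : R * R = R := by
    conv_lhs => rw [hR, Matrix.mul_sub, ← Matrix.mul_assoc, ← hR, hRV]
    simp
  have hRs : Rᴴ = R := by simp [hR]
  have hVn : ‖V‖ ≤ 1 := norm_le_one_of_isometry hV
  have hRn : ‖R‖ ≤ 1 := by
    have h := l2_opNorm_conjTranspose_mul_self R
    rw [hRs, hRR] at h
    nlinarith [norm_nonneg R]
  set U : Matrix (m ⊕ n) (n ⊕ m) ℂ := fromBlocks V R 0 Vᴴ with hU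
  have hUs : Uᴴ = fromBlocks Vᴴ 0 R V := by
    rw [hU, fromBlocks_conjTranspose]; simp [hRs]
  have h1 : Uᴴ * U = 1 := by
    rw [hUs, hU, fromBlocks_multiply]
    simp [hV, hVR, hRV, hRR]; simp [hR]
  have h2 : U * Uᴴ = 1 := by
    rw [hUs, hU, fromBlocks_multiply]
    simp [hV, hVR, hRV, hRR]; simp [hR]
  refine ⟨fun i => R * P i * R + V * ρ i * Vᴴ, _, (hP.dsum hρ).conj h1 h2, fun i => ?_⟩
  have hcol : ‖V * u i - P i * V‖ ≤ e := by rw [norm_sub_rev]; exact he i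
  have hrow : ‖u i * Vᴴ - Vᴴ * P i‖ ≤ e := by
    rw [← l2_opNorm_conjTranspose, ← norm_unitary_mul (hP.1 i), ← norm_mul_unitary (hu i)]
    have : P i * (u i * Vᴴ - Vᴴ * P i)ᴴ * u i =
        P i * V * (star (u i) * u i) - (P i * star (P i)) * V * u i := by
      simp [Matrix.mul_sub, Matrix.sub_mul, Matrix.mul_assoc, star_eq_conjTranspose]
    rw [this, Unitary.star_mul_self_of_mem (hu i), Unitary.mul_star_self_of_mem (hP.1 i)]
    simpa using he i
  have hid : dsum (u i) (R * P i * R + V * ρ i * Vᴴ) - Uᴴ * dsum (P i) (ρ i) * U =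
      fromBlocks (Vᴴ * (V * u i - P i * V)) ((u i * Vᴴ - Vᴴ * P i) * R)
        (R * (V * u i - P i * V)) 0 := by
    rw [hUs, hU, _root_.dsum, _root_.dsum, fromBlocks_multiply, fromBlocks_multiply,
      sub_eq_add_neg, fromBlocks_neg, fromBlocks_add]
    simp only [← sub_eq_add_neg]
    congr 1
    · simp [Matrix.mul_sub, ← Matrix.mul_assoc, hV]
    · simp [Matrix.sub_mul, Matrix.mul_assoc, hVR]
    · simp [Matrix.mul_sub, ← Matrix.mul_assoc, hRV]
    · simp [Matrix.mul_assoc]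
  rw [hid]
  have e0 : 0 ≤ e := (norm_nonneg _).trans hcol
  have hle : ∀ a b : ℝ, 0 ≤ a → a ≤ 1 → 0 ≤ b → b ≤ e → a * b ≤ e := fun a b h1 h2 h3 h4 => by
    nlinarith
  refine (norm_fromBlocks_le _ _ _).trans ?_
  have i1 : ‖Vᴴ * (V * u i - P i * V)‖ ≤ e := (l2_opNorm_mul _ _).trans
    (hle _ _ (norm_nonneg _) (by rwa [l2_opNorm_conjTranspose]) (norm_nonneg _) hcol)
  have i2 : ‖(u i * Vᴴ - Vᴴ * P i) * R‖ ≤ e := (l2_opNorm_mul _ _).trans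
    (by rw [mul_comm]; exact hle _ _ (norm_nonneg _) hRn (norm_nonneg _) hrow)
  have i3 : ‖R * (V * u i - P i * V)‖ ≤ e := (l2_opNorm_mul _ _).trans
    (hle _ _ (norm_nonneg _) hRn (norm_nonneg _) hcol)
  linarith

end Tuples

section Roots

variable {n : Type*} [Fintype n] [DecidableEq n]

lemma norm_eq_one_of_mem_spectrum {U : Matrix n n ℂ} (hU : U ∈ unitary (Matrix n n ℂ)) {z : ℂ}
    (hz : z ∈ spectrum ℂ U) : ‖z‖ = 1 := by
  simpa using Unitary.spectrum_subset_circle (⟨U, hU⟩ : unitary (Matrix n n ℂ)) hz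

lemma continuousOn_spectrum (U : Matrix n n ℂ) (f : ℂ → ℂ) : ContinuousOn f (spectrum ℂ U) :=
  U.finite_spectrum.continuousOn f

/-- The real powers of a unitary matrix, with principal branch. -/
def unitaryPow (U : Matrix n n ℂ) (t : ℝ) : Matrix n n ℂ :=
  cfc (fun z : ℂ => Complex.exp (Complex.I * (t * z.arg : ℝ))) U

variable {U : Matrix n n ℂ}

lemma unitaryPow_mem (hU : U ∈ unitary (Matrix n n ℂ)) (t : ℝ) :
    unitaryPow U t ∈ unitary (Matrix n n ℂ) := by
  have := isStarNormal_of_mem_unitary hU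
  rw [unitaryPow, cfc_unitary_iff _ _ this (continuousOn_spectrum _ _)]
  intro z _
  rw [Complex.star_def, ← Complex.exp_conj, ← Complex.exp_add]
  simp

lemma unitaryPow_add (s t : ℝ) :
    unitaryPow U (s + t) = unitaryPow U s * unitaryPow U t := by
  rw [unitaryPow, unitaryPow, unitaryPow,
    ← cfc_mul _ _ U (continuousOn_spectrum _ _) (continuousOn_spectrum _ _)]
  congr 1
  ext z
  rw [← Complex.exp_add]
  push_cast
  ring_nf

lemma unitaryPow_one (hU : U ∈ unitary (Matrix n n ℂ)) : unitaryPow U 1 = U := by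
  have := isStarNormal_of_mem_unitary hU
  conv_rhs => rw [← cfc_id' ℂ U]
  refine cfc_congr fun z hz => ?_
  have h := Complex.norm_mul_exp_arg_mul_I z
  rw [norm_eq_one_of_mem_spectrum hU hz] at h
  simpa [mul_comm] using h

lemma unitaryPow_zero (hU : U ∈ unitary (Matrix n n ℂ)) : unitaryPow U 0 = 1 := by
  have := isStarNormal_of_mem_unitary hU
  simp [unitaryPow, cfc_const_one ℂ U]

lemma norm_unitaryPow_sub_one_le (hU : U ∈ unitary (Matrix n n ℂ)) (t : ℝ) :
    ‖unitaryPow U t - 1‖ ≤ Real.pi * |t| := by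
  have := isStarNormal_of_mem_unitary hU
  rw [← cfc_const_one ℂ U, unitaryPow,
    ← cfc_sub _ _ U (continuousOn_spectrum _ _) (continuousOn_spectrum _ _)]
  refine norm_cfc_le (by positivity) fun z _ => Real.norm_exp_I_mul_ofReal_sub_one_le.trans ?_
  rw [Real.norm_eq_abs, abs_mul, mul_comm]
  gcongr
  exact Complex.abs_arg_le_pi z

lemma norm_unitaryPow_sub_one_le_two_mul (hU : U ∈ unitary (Matrix n n ℂ)) {t : ℝ}
    (ht : |t| ≤ 1) : ‖unitaryPow U t - 1‖ ≤ 2 * ‖U - 1‖ := by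
  have := isStarNormal_of_mem_unitary hU
  have h1 : U - 1 = cfc (fun z : ℂ => z - 1) U := by
    rw [cfc_sub _ _ U (continuousOn_spectrum _ _) (continuousOn_spectrum _ _), cfc_id' ℂ U,
      cfc_const_one ℂ U]
  rw [show unitaryPow U t - 1 = unitaryPow U t - cfc (fun _ : ℂ => (1 : ℂ)) U by
      rw [cfc_const_one ℂ U], unitaryPow,
    ← cfc_sub _ _ U (continuousOn_spectrum _ _) (continuousOn_spectrum _ _)]
  refine norm_cfc_le (by positivity) fun z hz => Real.norm_exp_I_mul_ofReal_sub_one_le.trans ?_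
  have h2 : ‖z - 1‖ ≤ ‖U - 1‖ := by
    rw [h1]
    exact norm_apply_le_norm_cfc (fun z : ℂ => z - 1) U hz (continuousOn_spectrum _ _)
  have hz1 := norm_eq_one_of_mem_spectrum hU hz
  have h3 := Complex.angle_le_mul_norm_sub hz1 (norm_one (α := ℂ))
  rw [Complex.angle_one_right (norm_ne_zero_iff.1 (by rw [hz1]; exact one_ne_zero))] at h3
  rw [Real.norm_eq_abs, abs_mul]
  calc |t| * |z.arg| ≤ 1 * (Real.pi / 2 * ‖z - 1‖) := by gcongr
    _ ≤ 2 * ‖U - 1‖ := by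
      rw [one_mul]
      have := Real.pi_lt_four
      gcongr
      linarith

lemma commute_unitaryPow (hU : U ∈ unitary (Matrix n n ℂ)) {C : Matrix n n ℂ}
    (h : Commute U C) (t : ℝ) : Commute (unitaryPow U t) C := by
  refine Commute.cfc h ?_ _
  have h1 := Unitary.star_mul_self_of_mem hU
  have h2 := Unitary.mul_star_self_of_mem hU
  calc star U * C = star U * (C * (U * star U)) := by rw [h2, mul_one]
    _ = star U * (C * U) * star U := by simp only [mul_assoc]
    _ = (star U * U) * C * star U := by rw [← h.eq]; simp only [mul_assoc]
    _ = C * star U := by rw [h1, one_mul]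

lemma exists_unitary_sq_eq (hU : U ∈ unitary (Matrix n n ℂ)) :
    ∃ Q ∈ unitary (Matrix n n ℂ), Q * Q = U :=
  ⟨unitaryPow U (1 / 2), unitaryPow_mem hU _, by
    rw [← unitaryPow_add, add_halves, unitaryPow_one hU]⟩

lemma exists_hermitian_diagonalization {A : Matrix n n ℂ} (hA : A.IsHermitian) :
    ∃ V ∈ unitary (Matrix n n ℂ), ∃ d : n → ℝ, A = V * diagonal (fun i => (d i : ℂ)) * Vᴴ :=
  ⟨hA.eigenvectorUnitary, hA.eigenvectorUnitary.2, hA.eigenvalues, by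
    conv_lhs => rw [hA.spectral_theorem]
    rfl⟩

lemma exists_unitary_diagonalization (hU : U ∈ unitary (Matrix n n ℂ)) :
    ∃ V ∈ unitary (Matrix n n ℂ), ∃ d : n → ℂ, (∀ i, ‖d i‖ = 1) ∧
      U = V * diagonal d * Vᴴ := by
  have := isStarNormal_of_mem_unitary hU
  have hH : IsSelfAdjoint (cfc (Complex.ofReal ∘ Complex.arg : ℂ → ℂ) U) := IsSelfAdjoint.cfc_arg U
  have h1 : U = NormedSpace.exp (Complex.I • cfc (Complex.ofReal ∘ Complex.arg : ℂ → ℂ) U) := by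
    rw [← cfc_const_mul _ _ U (continuousOn_spectrum _ _), ← CFC.complex_exp_eq_normedSpace_exp,
      ← cfc_comp' _ _ U (Complex.continuous_exp.continuousOn) (continuousOn_spectrum _ _)]
    conv_lhs => rw [← unitaryPow_one hU, unitaryPow]
    simp
  set H := cfc (Complex.ofReal ∘ Complex.arg : ℂ → ℂ) U
  obtain ⟨V, hV, d, hd⟩ := exists_hermitian_diagonalization (A := H) hH
  have hVs : V * Vᴴ = 1 := Unitary.mul_star_self_of_mem hV
  refine ⟨V, hV, fun i => Complex.exp (d i * Complex.I), fun i =>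
    Complex.norm_exp_ofReal_mul_I _, ?_⟩
  have h2 : Complex.I • H = V * diagonal (fun i => Complex.I * (d i : ℂ)) * V⁻¹ := by
    rw [inv_eq_right_inv hVs, hd, ← Matrix.smul_mul, ← Matrix.mul_smul, ← diagonal_smul]
    rfl
  rw [h1, h2, Matrix.exp_conj _ _ (IsUnit.of_mul_eq_one _ hVs), Matrix.exp_diagonal,
    inv_eq_right_inv hVs]
  congr 3
  ext i
  rw [Pi.coe_exp, Complex.exp_eq_exp_ℂ, mul_comm]

end Roots

section BlockPermutations

set_option linter.unusedSectionVars false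

variable {n K : Type*} [Fintype n] [DecidableEq n] [Fintype K] [DecidableEq K]

/-- The block matrix sending the block `l` to the block `σ l` through `B l`. -/
def blockPerm (σ : K → K) (B : K → Matrix n n ℂ) : Matrix (n × K) (n × K) ℂ :=
  of fun x y => if x.2 = σ y.2 then B y.2 x.1 y.1 else 0

lemma blockPerm_mul (σ τ : K → K) (B C : K → Matrix n n ℂ) :
    blockPerm σ B * blockPerm τ C = blockPerm (σ ∘ τ) fun l => B (τ l) * C l := by
  ext ⟨i, k⟩ ⟨j, l⟩
  simp only [blockPerm, mul_apply, of_apply, Fintype.sum_prod_type, Function.comp_apply]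
  split_ifs with h
  · refine Finset.sum_congr rfl fun x _ => ?_
    rw [Finset.sum_eq_single (τ l)] <;> simp +contextual [h]
  · refine Finset.sum_eq_zero fun x _ => Finset.sum_eq_zero fun y _ => ?_
    by_cases hy : y = τ l
    · subst hy; simp [h]
    · simp [hy]

lemma blockPerm_id_one : blockPerm id (fun _ : K => (1 : Matrix n n ℂ)) = 1 := by
  ext ⟨i, k⟩ ⟨j, l⟩
  simp only [blockPerm, of_apply, id, one_apply, Prod.mk.injEq]
  by_cases h : k = l <;> by_cases h' : i = j <;> simp [h, h']

/-- Block diagonal repetition of a matrix. -/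
def blockConst (K : Type*) [Fintype K] [DecidableEq K] :
    Matrix n n ℂ →* Matrix (n × K) (n × K) ℂ where
  toFun A := blockPerm id fun _ => A
  map_one' := blockPerm_id_one
  map_mul' A B := by rw [blockPerm_mul]; rfl

lemma blockPerm_mem_unitary {σ : K → K} (hσ : Function.Involutive σ) {B : K → Matrix n n ℂ}
    (hB : ∀ k, B k ∈ unitary (Matrix n n ℂ)) :
    blockPerm σ B ∈ unitary (Matrix (n × K) (n × K) ℂ) := by
  have h : (blockPerm σ B)ᴴ = blockPerm σ fun k => (B (σ k))ᴴ := by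
    ext ⟨i, k⟩ ⟨j, l⟩
    simp only [blockPerm, conjTranspose_apply, of_apply]
    by_cases h : k = σ l
    · subst h; simp [hσ l]
    · have : ¬ l = σ k := fun h' => h (by rw [h', hσ k])
      simp [h, this]
  apply mem_unitary_of_conjTranspose_mul
  rw [h, blockPerm_mul, hσ.comp_self, ← blockPerm_id_one]
  congr 1
  ext1 l
  rw [hσ l]
  exact Unitary.star_mul_self_of_mem (hB l)

/-- The column of blocks `E`. -/
def blockCol (E : K → Matrix n n ℂ) : Matrix (n × K) n ℂ := of fun x j => E x.2 x.1 j

lemma conjTranspose_blockCol_mul (E : K → Matrix n n ℂ) :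
    (blockCol E)ᴴ * blockCol E = ∑ k, (E k)ᴴ * E k := by
  ext i j
  simp only [blockCol, mul_apply, conjTranspose_apply, of_apply, Fintype.sum_prod_type,
    Matrix.sum_apply]
  exact Finset.sum_comm

lemma norm_blockCol_sq_le (E : K → Matrix n n ℂ) : ‖blockCol E‖ ^ 2 ≤ ∑ k, ‖E k‖ ^ 2 := by
  have h := l2_opNorm_conjTranspose_mul_self (blockCol E)
  rw [conjTranspose_blockCol_mul] at h
  rw [sq, ← h]
  refine (norm_sum_le _ _).trans (Finset.sum_le_sum fun k _ => ?_)
  rw [l2_opNorm_conjTranspose_mul_self, sq]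

lemma blockPerm_mul_blockCol {σ : K → K} (hσ : Function.Involutive σ) (B E : K → Matrix n n ℂ) :
    blockPerm σ B * blockCol E = blockCol fun k => B (σ k) * E (σ k) := by
  ext ⟨i, k⟩ j
  simp only [blockPerm, blockCol, mul_apply, of_apply, Fintype.sum_prod_type]
  refine Finset.sum_congr rfl fun x _ => ?_
  rw [Finset.sum_eq_single (σ k)]
  · simp [hσ k]
  · intro l _ hl
    have : ¬ k = σ l := fun h => hl (by rw [h, hσ l])
    simp [this]
  · simp

lemma blockCol_mul (E : K → Matrix n n ℂ) (A : Matrix n n ℂ) :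
    blockCol E * A = blockCol fun k => E k * A := by
  ext ⟨i, k⟩ j
  simp [blockCol, mul_apply]

lemma blockCol_sub (E F : K → Matrix n n ℂ) :
    blockCol E - blockCol F = blockCol fun k => E k - F k := rfl

/-- The normalized diagonal embedding into a direct sum of copies. -/
def diagEmb (n K : Type*) [Fintype n] [DecidableEq n] [Fintype K] [DecidableEq K] :
    Matrix (n × K) n ℂ :=
  blockCol fun _ => (((Real.sqrt (Fintype.card K))⁻¹ : ℝ) : ℂ) • 1

lemma conjTranspose_diagEmb_mul [Nonempty K] : (diagEmb n K)ᴴ * diagEmb n K = 1 := by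
  have h : (0 : ℝ) < Fintype.card K := by exact_mod_cast Fintype.card_pos
  rw [diagEmb, conjTranspose_blockCol_mul]
  simp only [conjTranspose_smul, conjTranspose_one, smul_mul_smul_comm, mul_one, Finset.sum_const,
    Finset.card_univ, Complex.star_def, Complex.conj_ofReal, ← Complex.ofReal_mul]
  rw [← mul_inv, Real.mul_self_sqrt h.le, ← Nat.cast_smul_eq_nsmul ℂ, smul_smul]
  push_cast
  rw [mul_inv_cancel₀ (by exact_mod_cast h.ne'), one_smul]

lemma norm_blockPerm_mul_diagEmb_sub_sq_le {σ : K → K} (hσ : Function.Involutive σ)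
    (B : K → Matrix n n ℂ) (u : Matrix n n ℂ) :
    ‖blockPerm σ B * diagEmb n K - diagEmb n K * u‖ ^ 2 ≤
      (Fintype.card K : ℝ)⁻¹ * ∑ k, ‖B k - u‖ ^ 2 := by
  rw [diagEmb, blockPerm_mul_blockCol hσ, blockCol_mul, blockCol_sub]
  refine (norm_blockCol_sq_le _).trans (le_of_eq ?_)
  rw [← Equiv.sum_comp (hσ.toPerm σ) fun k => ‖B k - u‖ ^ 2, Finset.mul_sum]
  refine Finset.sum_congr rfl fun k _ => ?_
  rw [Matrix.mul_smul, Matrix.smul_mul, Matrix.mul_one, Matrix.one_mul, ← smul_sub, norm_smul,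
    mul_pow]
  congr 1
  rw [Complex.norm_real, norm_inv, inv_pow, Real.norm_eq_abs, sq_abs,
    Real.sq_sqrt (Nat.cast_nonneg _)]

end BlockPermutations

section Ladder

variable {G : Type*} [Group G]

/-- The forward holonomy of the edge from node `k` to node `k + 1` of the ladder. -/
def edgeFwd (a b : G) (k : ℕ) : G := if Even k then a else b

/-- The squared holonomy at node `k` along the edge coming from node `k - 1`. -/
def nodeSq (a b w : G) : ℕ → G
  | 0 => b * b
  | k + 1 => edgeFwd a b k *
      (if Even k then (nodeSq a b w k * w)⁻¹ else (nodeSq a b w k)⁻¹ * w⁻¹) * (edgeFwd a b k)⁻¹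

/-- The backward holonomy of the edge from node `k + 1` to node `k` of the ladder. -/
def edgeBwd (a b w : G) (k : ℕ) : G := (edgeFwd a b k)⁻¹ * nodeSq a b w (k + 1)

/-- The node reached from node `k` along the edge labelled by the first generator. -/
def aStep (k : ℕ) : ℕ := if Even k then k + 1 else k - 1

/-- The node reached from node `k` along the edge labelled by the second generator, on the ladder
with last node `2 * N + 1`. -/
def bStep (N k : ℕ) : ℕ :=
  if k = 0 then 0 else if k = 2 * N + 1 then k else if Even k then k - 1 else k + 1

/-- The holonomy of the first generator at node `k`. -/
def aBlock (a b w : G) (k : ℕ) : G := if Even k then a else edgeBwd a b w (k - 1)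

/-- The holonomy of the second generator at node `k`, with `Q` at the last node `2 * N + 1`. -/
def bBlock (a b w Q : G) (N k : ℕ) : G :=
  if k = 0 then b else if k = 2 * N + 1 then Q else if Even k then edgeBwd a b w (k - 1) else b

lemma aStep_lt {N k : ℕ} (hk : k < 2 * N + 2) : aStep k < 2 * N + 2 := by
  unfold aStep; split_ifs with h
  · obtain ⟨r, rfl⟩ := h; omega
  · omega

lemma bStep_lt {N k : ℕ} (hk : k < 2 * N + 2) : bStep N k < 2 * N + 2 := by
  unfold bStep; split_ifs <;> omega

lemma aStep_aStep (k : ℕ) : aStep (aStep k) = k := by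
  rcases Nat.even_or_odd' k with ⟨r, rfl | rfl⟩
  · simp [aStep]
  · simp [aStep]

lemma bStep_bStep {N k : ℕ} (hk : k < 2 * N + 2) : bStep N (bStep N k) = k := by
  unfold bStep
  simp only [Nat.even_iff]
  by_cases h0 : k = 0
  · simp [h0]
  by_cases h1 : k = 2 * N + 1
  · simp [h1]
  by_cases h2 : k % 2 = 0
  · simp only [h0, h1, h2, if_true, if_false]
    rw [if_neg (by omega), if_neg (by omega), if_neg (by omega)]
    omega
  · simp only [h0, h1, h2, if_false]
    rw [if_neg (by omega), if_neg (by omega), if_pos (by omega)]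
    omega

lemma edgeFwd_mul_edgeBwd (a b w : G) (k : ℕ) :
    edgeFwd a b k * edgeBwd a b w k = nodeSq a b w (k + 1) := by
  simp [edgeBwd]

lemma edgeBwd_mul_edgeFwd (a b w : G) (k : ℕ) : edgeBwd a b w k * edgeFwd a b k =
    if Even k then (nodeSq a b w k * w)⁻¹ else (nodeSq a b w k)⁻¹ * w⁻¹ := by
  simp [edgeBwd, nodeSq, mul_assoc]

lemma ladder_relation (a b w : G) {Q : G} {N k : ℕ}
    (hk : k < 2 * N + 2) (hQ : Q * Q = (nodeSq a b w (2 * N + 1))⁻¹ * w⁻¹) :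
    aBlock a b w (aStep k) * aBlock a b w k *
      (bBlock a b w Q N (bStep N k) * bBlock a b w Q N k * w) = 1 := by
  rcases Nat.even_or_odd' k with ⟨r, rfl | rfl⟩
  · have hA : aBlock a b w (aStep (2 * r)) * aBlock a b w (2 * r) = (nodeSq a b w (2 * r) * w)⁻¹ := by
      have := edgeBwd_mul_edgeFwd a b w (2 * r)
      simpa [edgeFwd, aBlock, aStep] using this
    have hB : bBlock a b w Q N (bStep N (2 * r)) * bBlock a b w Q N (2 * r) =
        nodeSq a b w (2 * r) := by
      rcases r with _ | r
      · simp [bBlock, bStep, nodeSq]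
      · have h1 := edgeFwd_mul_edgeBwd a b w (2 * r + 1)
        have h2 : ¬ 2 * r + 1 = 2 * N + 1 := by omega
        have h3 : ¬ 2 * (r + 1) = 2 * N + 1 := by omega
        have h4 : bStep N (2 * (r + 1)) = 2 * r + 1 := by
          unfold bStep
          rw [if_neg (by omega), if_neg h3, if_pos (even_two_mul _)]; rfl
        have h5 : bBlock a b w Q N (2 * r + 1) = b := by simp [bBlock]; omega
        have h6 : bBlock a b w Q N (2 * (r + 1)) = edgeBwd a b w (2 * r + 1) := by
          unfold bBlock
          rw [if_neg (by omega), if_neg h3, if_pos (even_two_mul _)]; rfl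
        have h7 : edgeFwd a b (2 * r + 1) = b := by simp [edgeFwd]
        rw [h7] at h1
        rw [h4, h5, h6, h1]
        rfl
    rw [hA, hB, inv_mul_cancel]
  · have hA : aBlock a b w (aStep (2 * r + 1)) * aBlock a b w (2 * r + 1) =
        nodeSq a b w (2 * r + 1) := by
      have := edgeFwd_mul_edgeBwd a b w (2 * r)
      simpa [edgeFwd, aBlock, aStep] using this
    have hB : bBlock a b w Q N (bStep N (2 * r + 1)) * bBlock a b w Q N (2 * r + 1) =
        (nodeSq a b w (2 * r + 1))⁻¹ * w⁻¹ := by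
      by_cases h : r = N
      · subst h; simp [bBlock, bStep, hQ]
      · have := edgeBwd_mul_edgeFwd a b w (2 * r + 1)
        have h3 : 2 * r + 1 ≠ 2 * N := by omega
        have h4 : Even (2 * r + 1 + 1) := by rw [Nat.even_iff]; omega
        simpa [edgeFwd, bBlock, bStep, h, h3, h4] using this
    rw [hA, hB]; group

end Ladder

section LadderEstimates

variable {G : Type*} [Group G] [PseudoMetricSpace G] [IsIsometricSMul G G]
  [IsIsometricSMul Gᵐᵒᵖ G] {a b w : G} {δ : ℝ}

lemma dist_mul_mul (c d x y : G) : dist (c * x * d) (c * y * d) = dist x y := by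
  rw [dist_mul_right, dist_mul_left]

lemma dist_nodeSq_succ_le (h : dist (a * a * (b * b * w)) 1 ≤ δ) (k : ℕ) :
    dist (nodeSq a b w (k + 1)) (edgeFwd a b k * edgeFwd a b k) ≤ (k + 1) * δ := by
  have heven (X : G) : dist (a * (X * w)⁻¹ * a⁻¹) (a * a) = dist 1 (a * a * (X * w)) := by
    rw [← dist_mul_mul (a * (a * X * w * a⁻¹)) a⁻¹]
    congr 1 <;> group
  have hodd (X : G) : dist (b * (X⁻¹ * w⁻¹) * b⁻¹) (b * b) = dist 1 (X * (b * b * w)) := by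
    rw [← dist_mul_mul (X * b⁻¹) (b * w)]
    congr 1 <;> group
  rw [dist_comm] at h
  induction k with
  | zero =>
    rw [nodeSq]
    simp only [edgeFwd, Even.zero, if_true, heven]
    simpa [nodeSq] using h
  | succ k ih =>
    have hk : dist 1 (a * a * (b * b * w)) + dist (nodeSq a b w (k + 1))
        (edgeFwd a b k * edgeFwd a b k) ≤ (↑(k + 1) + 1) * δ := by
      push_cast; linarith
    refine le_trans ?_ hk
    rw [nodeSq]
    by_cases hev : Even (k + 1)
    · have hk' : ¬ Even k := by rwa [Nat.even_add_one] at hev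
      simp only [edgeFwd, hev, hk', if_true, if_false, heven]
      refine (dist_triangle _ (a * a * (b * b * w)) _).trans ?_
      rw [dist_mul_left, dist_mul_right, dist_comm (b * b)]
    · have hk' : Even k := by rw [Nat.even_add_one] at hev; exact not_not.1 hev
      simp only [edgeFwd, hev, hk', if_true, if_false, hodd]
      refine (dist_triangle _ (a * a * (b * b * w)) _).trans ?_
      rw [dist_mul_right, dist_comm (a * a)]

lemma dist_edgeBwd_edgeFwd_le (h : dist (a * a * (b * b * w)) 1 ≤ δ) (k : ℕ) :
    dist (edgeBwd a b w k) (edgeFwd a b k) ≤ (k + 1) * δ := by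
  rw [← dist_mul_left (edgeFwd a b k), edgeFwd_mul_edgeBwd]
  exact dist_nodeSq_succ_le h k

lemma dist_aBlock_le (h : dist (a * a * (b * b * w)) 1 ≤ δ) (k : ℕ) :
    dist (aBlock a b w k) a ≤ k * δ := by
  have h0 : 0 ≤ δ := dist_nonneg.trans h
  unfold aBlock
  split_ifs with hk
  · simp; positivity
  · obtain ⟨r, rfl⟩ := Nat.not_even_iff_odd.1 hk
    have := dist_edgeBwd_edgeFwd_le h (2 * r)
    simpa [edgeFwd] using this

lemma dist_bBlock_le (h : dist (a * a * (b * b * w)) 1 ≤ δ) {Q : G} {N k : ℕ}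
    (hk : k ≠ 2 * N + 1) : dist (bBlock a b w Q N k) b ≤ k * δ := by
  have h0 : 0 ≤ δ := dist_nonneg.trans h
  unfold bBlock
  split_ifs with h1 h2
  · simp; positivity
  · obtain ⟨r, rfl | rfl⟩ := Nat.even_or_odd' k
    · obtain ⟨r, rfl⟩ := Nat.exists_eq_succ_of_ne_zero (n := r) (by rintro rfl; exact h1 rfl)
      have := dist_edgeBwd_edgeFwd_le h (2 * r + 1)
      have h3 : edgeFwd a b (2 * r + 1) = b := by simp [edgeFwd]
      rw [h3] at this
      refine (show dist (edgeBwd a b w (2 * r + 1)) b ≤ _ from this).trans_eq ?_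
      push_cast; ring
    · exact absurd h2 (by simp)
  · simp; positivity

end LadderEstimates

section LadderComplement

variable {n : Type*} [Fintype n] [DecidableEq n]

lemma isIsometricSMul_unitary :
    IsIsometricSMul (unitary (Matrix n n ℂ)) (unitary (Matrix n n ℂ)) :=
  ⟨fun c => Isometry.of_dist_eq fun x y => by
    simp only [Subtype.dist_eq, dist_eq_norm, smul_eq_mul, Submonoid.coe_mul]
    rw [← mul_sub]
    exact norm_unitary_mul c.2 _⟩

lemma isIsometricSMul_op_unitary :
    IsIsometricSMul (unitary (Matrix n n ℂ))ᵐᵒᵖ (unitary (Matrix n n ℂ)) :=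
  ⟨fun c => Isometry.of_dist_eq fun x y => by
    simp only [Subtype.dist_eq, dist_eq_norm, MulOpposite.smul_eq_mul_unop, Submonoid.coe_mul]
    rw [← sub_mul]
    exact norm_mul_unitary c.unop.2 _⟩

end LadderComplement

section LadderComplement

variable {n : Type*} [Fintype n] [DecidableEq n]

lemma norm_blockPerm_mul_diagEmb_sub_le {N : ℕ} {σ : Fin (2 * N + 2) → Fin (2 * N + 2)}
    (hσ : Function.Involutive σ) {B : Fin (2 * N + 2) → Matrix n n ℂ} {u : Matrix n n ℂ}
    {η e : ℝ} (he : 0 ≤ e) (hη : η ^ 2 + 4 / (2 * N + 2) ≤ e ^ 2)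
    (hB : ∀ k : Fin (2 * N + 2), (k : ℕ) ≠ 2 * N + 1 → ‖B k - u‖ ≤ η)
    (hB' : ∀ k, ‖B k - u‖ ≤ 2) :
    ‖blockPerm σ B * diagEmb n (Fin (2 * N + 2)) - diagEmb n (Fin (2 * N + 2)) * u‖ ≤ e := by
  refine le_of_sq_le_sq ?_ he
  refine (norm_blockPerm_mul_diagEmb_sub_sq_le hσ B u).trans (le_trans ?_ hη)
  have hk (k : Fin (2 * N + 2)) :
      ‖B k - u‖ ^ 2 ≤ η ^ 2 + if k = Fin.last (2 * N + 1) then 4 else 0 := by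
    split_ifs with h
    · have := hB' k
      nlinarith [norm_nonneg (B k - u), sq_nonneg η]
    · have h' := hB k fun h1 => h (Fin.ext h1)
      rw [add_zero]
      gcongr
  have hs := Finset.sum_le_sum fun k (_ : k ∈ Finset.univ) => hk k
  rw [Finset.sum_add_distrib, Finset.sum_ite_eq'] at hs
  simp only [Finset.sum_const, Finset.card_univ, Fintype.card_fin, nsmul_eq_mul,
    Finset.mem_univ, if_true] at hs ⊢
  push_cast at hs ⊢
  rw [inv_mul_le_iff₀ (by positivity)]
  refine hs.trans_eq ?_
  field_simp

lemma norm_sub_le_two {A B : Matrix n n ℂ} (hA : A ∈ unitary (Matrix n n ℂ))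
    (hB : B ∈ unitary (Matrix n n ℂ)) : ‖A - B‖ ≤ 2 := by
  have := norm_sub_le A B
  linarith [norm_le_one_of_mem_unitary hA, norm_le_one_of_mem_unitary hB]

lemma isFlat_one {k : ℕ} : IsFlat fun _ : Fin k => (1 : Matrix n n ℂ) :=
  ⟨fun _ => one_mem _, by simp [sqProd]⟩

theorem exists_complement_of_norm_sqProd_sub_one_le (k : ℕ) {e : ℝ} (he : 0 < e) :
    ∃ δ > 0, ∀ (n : Type) [Fintype n] [DecidableEq n] (u : Fin (k + 2) → Matrix n n ℂ),
      (∀ i, u i ∈ unitary (Matrix n n ℂ)) → ‖sqProd u - 1‖ ≤ δ →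
      ∃ (κ : Type) (_ : Fintype κ) (_ : DecidableEq κ) (v : Fin (k + 2) → Matrix κ κ ℂ)
        (Q : Fin (k + 2) → Matrix (n ⊕ κ) (n ⊕ κ) ℂ), IsFlat Q ∧
        ∀ i, ‖dsum (u i) (v i) - Q i‖ ≤ e := by
  obtain ⟨N, hN⟩ := exists_nat_gt (36 / e ^ 2)
  have hN2 : 4 / (2 * N + 2) ≤ (e / 3) ^ 2 / 2 := by
    rw [div_lt_iff₀ (by positivity)] at hN
    rw [div_le_iff₀ (by positivity)]
    nlinarith [sq_nonneg e]
  refine ⟨e / (6 * (2 * N + 1)), by positivity, fun n _ _ u hu hδ => ?_⟩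
  set δ := e / (6 * (2 * N + 1)) with hδdef
  have hη : ((2 * N + 1) * δ) ^ 2 + 4 / (2 * N + 2) ≤ (e / 3) ^ 2 := by
    have : (2 * N + 1) * δ = e / 6 := by rw [hδdef]; field_simp
    rw [this]; nlinarith [sq_nonneg e]
  have := isIsometricSMul_unitary (n := n)
  have := isIsometricSMul_op_unitary (n := n)
  let H := unitary (Matrix n n ℂ)
  let U : Fin (k + 2) → H := fun i => ⟨u i, hu i⟩
  let a : H := U 0
  let b : H := U 1
  let w : H := sqProd fun i : Fin k => U i.succ.succ
  have hsq : sqProd U = a * a * (b * b * w) := by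
    rw [sqProd_succ, sqProd_succ]; rfl
  have hUu : sqProd u = (sqProd U : H) := (map_sqProd (unitary (Matrix n n ℂ)).subtype U).symm
  have hd : dist (a * a * (b * b * w)) 1 ≤ δ := by
    rw [← hsq, Subtype.dist_eq, ← hUu, dist_eq_norm]; exact hδ
  obtain ⟨Q, hQu, hQ⟩ := exists_unitary_sq_eq (((nodeSq a b w (2 * N + 1))⁻¹ * w⁻¹ : H).2)
  obtain ⟨Q, rfl⟩ : ∃ Q' : H, (Q' : Matrix n n ℂ) = Q := ⟨⟨Q, hQu⟩, rfl⟩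
  have hQ' : Q * Q = (nodeSq a b w (2 * N + 1))⁻¹ * w⁻¹ := Subtype.ext hQ
  let K := Fin (2 * N + 2)
  let σa : K → K := fun l => ⟨aStep l, aStep_lt l.2⟩
  let σb : K → K := fun l => ⟨bStep N l, bStep_lt l.2⟩
  have hσa : Function.Involutive σa := fun l => Fin.ext (aStep_aStep _)
  have hσb : Function.Involutive σb := fun l => Fin.ext (bStep_bStep l.2)
  let A : K → Matrix n n ℂ := fun l => (aBlock a b w l : H)
  let B : K → Matrix n n ℂ := fun l => (bBlock a b w Q N l : H)
  let P : Fin (k + 2) → Matrix (n × K) (n × K) ℂ :=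
    Fin.cons (blockPerm σa A) (Fin.cons (blockPerm σb B) fun i => blockConst K (u i.succ.succ))
  have hid : Function.Involutive (id : K → K) := fun _ => rfl
  have hP : IsFlat P := by
    constructor
    · refine Fin.cases ?_ (Fin.cases ?_ fun i => ?_)
      · exact blockPerm_mem_unitary hσa fun l => (aBlock a b w l : H).2
      · exact blockPerm_mem_unitary hσb fun l => (bBlock a b w Q N l : H).2
      · exact blockPerm_mem_unitary hid fun l => hu _
    · have hw : (sqProd fun i : Fin k => P i.succ.succ) = blockPerm id fun _ => (w : Matrix n n ℂ) := by
        have h1 : ((w : H) : Matrix n n ℂ) = sqProd fun i : Fin k => u i.succ.succ :=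
          map_sqProd (unitary (Matrix n n ℂ)).subtype _
        rw [h1]
        exact (map_sqProd (blockConst (n := n) K) _).symm
      rw [sqProd_succ, sqProd_succ]
      refine (congrArg _ (congrArg _ hw)).trans ?_
      change blockPerm σa A * blockPerm σa A * (blockPerm σb B * blockPerm σb B * _) = 1
      simp only [blockPerm_mul, hσa.comp_self, hσb.comp_self, Function.comp_id]
      rw [← blockPerm_id_one]
      congr 1
      ext1 l
      have := congrArg (Subtype.val) (ladder_relation a b w (N := N) (k := l) l.2 hQ')
      exact this
  have hδ0 : 0 ≤ δ := dist_nonneg.trans hd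
  have hmono (l : K) : (l : ℕ) * δ ≤ (2 * N + 1) * δ := by
    gcongr
    exact_mod_cast Nat.lt_succ_iff.1 l.2
  obtain ⟨v, R, hR, hv⟩ := exists_complement_of_isometry (V := diagEmb n K) (u := u)
    (e := e / 3) conjTranspose_diagEmb_mul hP isFlat_one hu (by
      refine Fin.cases ?_ (Fin.cases ?_ fun i => ?_)
      · refine norm_blockPerm_mul_diagEmb_sub_le hσa (by positivity) hη (fun l hl => ?_)
          fun l => norm_sub_le_two (aBlock a b w l : H).2 (hu _)
        exact (dist_eq_norm (A l) (u 0)).symm.trans_le ((dist_aBlock_le hd l).trans (hmono l))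
      · refine norm_blockPerm_mul_diagEmb_sub_le hσb (by positivity) hη (fun l hl => ?_)
          fun l => norm_sub_le_two (bBlock a b w Q N l : H).2 (hu _)
        exact (dist_eq_norm (B l) (u 1)).symm.trans_le ((dist_bBlock_le hd hl).trans (hmono l))
      · refine norm_blockPerm_mul_diagEmb_sub_le hid (by positivity) hη (fun l hl => ?_)
          fun l => norm_sub_le_two (hu _) (hu _)
        simp; positivity)
  exact ⟨n × K, inferInstance, inferInstance, v, R, hR, fun i => (hv i).trans_eq (by ring)⟩

end LadderComplement

section RootChains

variable {n : Type*} [Fintype n] [DecidableEq n]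

lemma mul_diagonal_mul_mem_unitary {V : Matrix n n ℂ} (hV : V ∈ unitary (Matrix n n ℂ))
    {d : n → ℂ} (hd : ∀ i, ‖d i‖ = 1) : V * diagonal d * Vᴴ ∈ unitary (Matrix n n ℂ) := by
  refine mul_mem (mul_mem hV (mem_unitary_of_conjTranspose_mul ?_)) (Unitary.star_mem hV)
  rw [diagonal_conjTranspose, diagonal_mul_diagonal, ← diagonal_one]
  congr 1
  ext i
  simp [← Complex.normSq_eq_conj_mul_self, Complex.normSq_eq_norm_sq, hd]

lemma mul_diagonal_mul_mul_self {V : Matrix n n ℂ} (hV : V ∈ unitary (Matrix n n ℂ))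
    (d : n → ℂ) : V * diagonal d * Vᴴ * (V * diagonal d * Vᴴ) =
      V * diagonal (fun i => d i * d i) * Vᴴ := by
  calc V * diagonal d * Vᴴ * (V * diagonal d * Vᴴ)
      = V * diagonal d * (star V * V) * diagonal d * Vᴴ := by
        simp only [star_eq_conjTranspose, Matrix.mul_assoc]
    _ = _ := by
      rw [Unitary.star_mul_self_of_mem hV, mul_one, Matrix.mul_assoc V, diagonal_mul_diagonal]

lemma roots_charpoly_mul_diagonal_mul {V : Matrix n n ℂ} (hV : V ∈ unitary (Matrix n n ℂ))
    (d : n → ℂ) : (V * diagonal d * Vᴴ).charpoly.roots = Finset.univ.val.map d := by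
  rw [charpoly_mul_comm, ← Matrix.mul_assoc, ← star_eq_conjTranspose,
    Unitary.star_mul_self_of_mem hV, one_mul, charpoly_diagonal]
  have := Polynomial.roots_multiset_prod_X_sub_C (Finset.univ.val.map d)
  rwa [Multiset.map_map] at this

lemma exists_perm_of_map_univ_eq {α β : Type*} [Fintype α] [DecidableEq β] {f g : α → β}
    (h : (Finset.univ : Finset α).val.map f = (Finset.univ : Finset α).val.map g) :
    ∃ e : Equiv.Perm α, f = g ∘ e := by
  classical
  have hc (z : β) : Nonempty ({a // f a = z} ≃ {a // g a = z}) := by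
    have := congrArg (Multiset.count z) h
    rw [Multiset.count_map, Multiset.count_map] at this
    rw [← Fintype.card_eq, Fintype.card_subtype, Fintype.card_subtype]
    simpa [eq_comm, Finset.card_def] using this
  refine ⟨Equiv.ofFiberEquiv fun z => (hc z).some, ?_⟩
  ext1 a
  exact (Equiv.ofFiberEquiv_map _ a).symm

/-- Two unitary square roots of a unitary matrix differ, up to a choice of signs, by conjugation
with a unitary commuting with that matrix. -/
lemma exists_commute_conj_eq_diagonal {C V : Matrix n n ℂ} {d : n → ℂ}
    (hC : C ∈ unitary (Matrix n n ℂ)) (hV : V ∈ unitary (Matrix n n ℂ))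
    (h : C * C = V * diagonal d * Vᴴ) :
    ∃ Y ∈ unitary (Matrix n n ℂ), ∃ τ : n → ℂ, (∀ i, ‖τ i‖ = 1) ∧ (∀ i, τ i * τ i = d i) ∧
      Commute Y (C * C) ∧ Y * C * Yᴴ = V * diagonal τ * Vᴴ := by
  obtain ⟨W, hW, σ, hσ, hCσ⟩ := exists_unitary_diagonalization hC
  have hsq := mul_diagonal_mul_mul_self hW σ
  rw [← hCσ, h] at hsq
  have hr := congrArg (fun M => M.charpoly.roots) hsq
  simp only [roots_charpoly_mul_diagonal_mul hV, roots_charpoly_mul_diagonal_mul hW] at hr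
  obtain ⟨e, he⟩ := exists_perm_of_map_univ_eq hr
  set X : Matrix n n ℂ := W.submatrix id e with hX
  have hXu : X ∈ unitary (Matrix n n ℂ) := by
    apply mem_unitary_of_conjTranspose_mul
    rw [hX, conjTranspose_submatrix, ← submatrix_mul _ _ _ _ _ Function.bijective_id,
      ← star_eq_conjTranspose, Unitary.star_mul_self_of_mem hW, submatrix_one_equiv]
  have hXσ : C = X * diagonal (σ ∘ e) * Xᴴ := by
    rw [hX, conjTranspose_submatrix, ← submatrix_diagonal_equiv,
      ← submatrix_mul _ _ _ _ _ e.bijective, ← submatrix_mul _ _ _ _ _ e.bijective,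
      submatrix_id_id, ← hCσ]
  have hXs := Unitary.star_mul_self_of_mem hXu
  have hVs := Unitary.star_mul_self_of_mem hV
  rw [star_eq_conjTranspose] at hXs hVs
  have hconj (D : Matrix n n ℂ) : V * Xᴴ * (X * D * Xᴴ) * (V * Xᴴ)ᴴ = V * D * Vᴴ := by
    calc _ = V * (Xᴴ * X) * D * (Xᴴ * X) * Vᴴ := by
          simp only [conjTranspose_mul, conjTranspose_conjTranspose, Matrix.mul_assoc]
      _ = _ := by rw [hXs, mul_one, mul_one]
  have hY : V * Xᴴ ∈ unitary (Matrix n n ℂ) := mul_mem hV (Unitary.star_mem hXu)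
  refine ⟨V * Xᴴ, hY, σ ∘ e, fun i => hσ _, fun i => (congrFun he i).symm, ?_, ?_⟩
  · have h1 : V * Xᴴ * (C * C) * (V * Xᴴ)ᴴ = C * C := by
      conv_rhs => rw [h]
      rw [hXσ, mul_diagonal_mul_mul_self hXu, hconj, he]
      rfl
    have h2 := Unitary.star_mul_self_of_mem hY
    rw [star_eq_conjTranspose] at h2
    calc V * Xᴴ * (C * C) = V * Xᴴ * (C * C) * ((V * Xᴴ)ᴴ * (V * Xᴴ)) := by rw [h2, mul_one]
      _ = V * Xᴴ * (C * C) * (V * Xᴴ)ᴴ * (V * Xᴴ) := by simp only [Matrix.mul_assoc]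
      _ = _ := by rw [h1]
  · rw [← hconj, ← hXσ]

end RootChains

section RootChains

open Filter Topology

variable {n : Type*} [Fintype n] [DecidableEq n]

lemma norm_conj_sub_le {C Z : Matrix n n ℂ} (hC : C ∈ unitary (Matrix n n ℂ))
    (hZ : Z ∈ unitary (Matrix n n ℂ)) : ‖C - Z * C * Zᴴ‖ ≤ 2 * ‖Z - 1‖ := by
  have h1 : (C - Z * C * Zᴴ) * Z = C * (Z - 1) - (Z - 1) * C := by
    have h := Unitary.star_mul_self_of_mem hZ
    rw [star_eq_conjTranspose] at h
    rw [Matrix.sub_mul, Matrix.mul_assoc (Z * C), h]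
    noncomm_ring
  rw [← norm_mul_unitary hZ, h1]
  refine (norm_sub_le _ _).trans ?_
  rw [norm_unitary_mul hC, norm_mul_unitary hC, two_mul]

lemma conj_mem_unitary {C Z : Matrix n n ℂ} (hC : C ∈ unitary (Matrix n n ℂ))
    (hZ : Z ∈ unitary (Matrix n n ℂ)) : Z * C * Zᴴ ∈ unitary (Matrix n n ℂ) :=
  mul_mem (mul_mem hZ hC) (Unitary.star_mem hZ)

lemma conj_mul_self_of_commute {C Z : Matrix n n ℂ} (hZ : Z ∈ unitary (Matrix n n ℂ))
    (h : Commute Z (C * C)) : Z * C * Zᴴ * (Z * C * Zᴴ) = C * C := by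
  have h1 := Unitary.star_mul_self_of_mem hZ
  have h2 := Unitary.mul_star_self_of_mem hZ
  rw [star_eq_conjTranspose] at h1 h2
  calc _ = Z * (C * (Zᴴ * Z) * C) * Zᴴ := by simp only [Matrix.mul_assoc]
    _ = _ := by rw [h1, mul_one, h.eq, Matrix.mul_assoc, h2, mul_one]

/-- Conjugate square roots of a unitary matrix are joined by a chain of square roots with small
steps. -/
lemma prop_of_prop_conj {C Y : Matrix n n ℂ} (hC : C ∈ unitary (Matrix n n ℂ))
    (hY : Y ∈ unitary (Matrix n n ℂ)) (hcomm : Commute Y (C * C)) {ε : ℝ} (hε : 0 < ε)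
    {P : Matrix n n ℂ → Prop}
    (hP : ∀ A ∈ unitary (Matrix n n ℂ), ∀ B ∈ unitary (Matrix n n ℂ), A * A = C * C → P B →
      ‖A - B‖ < ε → P A)
    (h : P (Y * C * Yᴴ)) : P C := by
  obtain ⟨M, hM⟩ := exists_nat_gt (2 * Real.pi / ε)
  have hM0 : (0 : ℝ) < M := lt_of_le_of_lt (by positivity) hM
  have key : ∀ k : ℕ, P (unitaryPow Y (1 - k / M) * C * (unitaryPow Y (1 - k / M))ᴴ) := by
    intro k
    induction k with
    | zero => simpa [unitaryPow_one hY] using h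
    | succ k ih =>
      have hZ := unitaryPow_mem hY (1 - (k + 1 : ℕ) / M)
      have hS := unitaryPow_mem hY (1 / M)
      refine hP _ (conj_mem_unitary hC hZ) _ (conj_mem_unitary hC (unitaryPow_mem hY _))
        (conj_mul_self_of_commute hZ (commute_unitaryPow hY hcomm _)) ih ?_
      have h1 : unitaryPow Y (1 - k / M) =
          unitaryPow Y (1 - (k + 1 : ℕ) / M) * unitaryPow Y (1 / M) := by
        rw [← unitaryPow_add]
        congr 1
        push_cast
        field_simp
        ring
      have h2 : ∀ Z S : Matrix n n ℂ, Z * C * Zᴴ - Z * S * C * (Z * S)ᴴ =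
          Z * (C - S * C * Sᴴ) * Zᴴ := fun Z S => by
        rw [conjTranspose_mul]; noncomm_ring
      rw [h1, h2, ← star_eq_conjTranspose (unitaryPow Y (1 - (k + 1 : ℕ) / M)),
        norm_mul_unitary (Unitary.star_mem hZ), norm_unitary_mul hZ]
      refine (norm_conj_sub_le hC hS).trans_lt ?_
      have h3 := norm_unitaryPow_sub_one_le hY (1 / M)
      rw [abs_of_pos (by positivity)] at h3
      rw [div_lt_iff₀ hε] at hM
      calc _ ≤ 2 * (Real.pi * (1 / M)) := by gcongr
        _ = 2 * Real.pi / M := by ring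
        _ < ε := by rw [div_lt_iff₀ hM0]; linarith
  have := key M
  rw [div_self hM0.ne', sub_self, unitaryPow_zero hY] at this
  simpa using this

/-- Near-roots of a unitary matrix are joined to roots by chains of near-roots. -/
lemma exists_chain_to_root (n : Type*) [Fintype n] [DecidableEq n] {ε : ℝ} (hε : 0 < ε) :
    ∃ η > 0, ∀ C ∈ unitary (Matrix n n ℂ), ∀ D ∈ unitary (Matrix n n ℂ), ‖C * C - D‖ < η →
      ∀ P : Matrix n n ℂ → Prop,
        (∀ A ∈ unitary (Matrix n n ℂ), ∀ B ∈ unitary (Matrix n n ℂ), P B → ‖A - B‖ < ε →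
          ‖A * A - D‖ < ε → P A) →
        (∀ A ∈ unitary (Matrix n n ℂ), A * A = D → P A) → P C := by
  by_contra! hcon
  choose C hC D hD hCD P hP hroot hnot using
    fun m : ℕ => hcon (1 / (m + 1)) Nat.one_div_pos_of_nat
  choose V hV d hd hDV using fun m => exists_unitary_diagonalization (hD m)
  have : ProperSpace (Matrix n n ℂ) := FiniteDimensional.proper ℂ _
  have hbdd : Bornology.IsBounded
      (Metric.closedBall (0 : Matrix n n ℂ × Matrix n n ℂ × (n → ℂ)) 1) :=
    Metric.isBounded_closedBall
  have hmem : ∀ m, (C m, V m, d m) ∈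
      Metric.closedBall (0 : Matrix n n ℂ × Matrix n n ℂ × (n → ℂ)) 1 := fun m => by
    simp only [mem_closedBall_zero_iff, Prod.norm_def, max_le_iff]
    exact ⟨norm_le_one_of_mem_unitary (hC m), norm_le_one_of_mem_unitary (hV m),
      (pi_norm_le_iff_of_nonneg zero_le_one).2 fun i => (hd m i).le⟩
  obtain ⟨⟨C₀, V₀, d₀⟩, -, φ, hφ, hlim⟩ := tendsto_subseq_of_bounded hbdd hmem
  rw [Prod.tendsto_iff, Prod.tendsto_iff] at hlim
  obtain ⟨hlC, hlV, hld⟩ := hlim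
  simp only [Function.comp_def] at hlC hlV hld
  have hC₀ : C₀ ∈ unitary (Matrix n n ℂ) :=
    isClosed_unitary.mem_of_tendsto hlC (Filter.Eventually.of_forall fun m => hC _)
  have hV₀ : V₀ ∈ unitary (Matrix n n ℂ) :=
    isClosed_unitary.mem_of_tendsto hlV (Filter.Eventually.of_forall fun m => hV _)
  have hconj : ∀ (f : ℕ → n → ℂ) (f₀ : n → ℂ), Tendsto f atTop (𝓝 f₀) →
      Tendsto (fun m => V (φ m) * diagonal (f m) * (V (φ m))ᴴ) atTop
        (𝓝 (V₀ * diagonal f₀ * V₀ᴴ)) := fun f f₀ hf =>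
    (hlV.mul ((continuous_id.matrix_diagonal.tendsto f₀).comp hf)).mul
      ((continuous_id.matrix_conjTranspose.tendsto V₀).comp hlV)
  have hlD : Tendsto (fun m => D (φ m)) atTop (𝓝 (V₀ * diagonal d₀ * V₀ᴴ)) := by
    simpa only [← hDV] using hconj _ _ hld
  have hsq : C₀ * C₀ = V₀ * diagonal d₀ * V₀ᴴ := by
    have h1 : Tendsto (fun m => C (φ m) * C (φ m) - D (φ m)) atTop (𝓝 0) := by
      refine squeeze_zero_norm (fun m => (hCD (φ m)).le) ?_
      exact tendsto_one_div_add_atTop_nhds_zero_nat.comp hφ.tendsto_atTop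
    exact sub_eq_zero.1 (tendsto_nhds_unique ((hlC.mul hlC).sub hlD) h1)
  obtain ⟨Y, hY, τ, hτ, hτd, hcomm, hconjY⟩ := exists_commute_conj_eq_diagonal hC₀ hV₀ hsq
  have hτ0 (i : n) : τ i * τ i ≠ 0 := by
    have : τ i ≠ 0 := by rw [← norm_ne_zero_iff, hτ i]; exact one_ne_zero
    exact mul_ne_zero this this
  set r : ℕ → n → ℂ := fun m i => τ i * (d (φ m) i / (τ i * τ i)) ^ (((2 : ℕ) : ℂ)⁻¹) with hr
  have hrr (m : ℕ) (i : n) : r m i * r m i = d (φ m) i := by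
    have h := Complex.cpow_nat_inv_pow (d (φ m) i / (τ i * τ i)) two_ne_zero
    rw [hr]
    simp only
    rw [mul_mul_mul_comm, ← sq (_ ^ _), h]
    exact mul_div_cancel₀ _ (hτ0 i)
  have hrn (m : ℕ) (i : n) : ‖r m i‖ = 1 := by
    have h := congrArg norm (hrr m i)
    rw [norm_mul, hd] at h
    nlinarith [norm_nonneg (r m i)]
  have hlr : Tendsto r atTop (𝓝 τ) := by
    rw [tendsto_pi_nhds]
    intro i
    have h1 : Tendsto (fun m => d (φ m) i / (τ i * τ i)) atTop (𝓝 1) := by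
      have := ((tendsto_pi_nhds.1 hld) i).div_const (τ i * τ i)
      rwa [← hτd, div_self (hτ0 i)] at this
    have h2 : ContinuousAt (fun z : ℂ => z ^ (((2 : ℕ) : ℂ)⁻¹)) 1 :=
      continuousAt_cpow_const (by simp [Complex.slitPlane])
    simpa [hr] using (h2.tendsto.comp h1).const_mul (τ i)
  have hε2 : 0 < ε / 2 := half_pos hε
  have e1 := (Metric.tendsto_nhds.1 hlC) ε hε
  have e2 := (Metric.tendsto_nhds.1 hlD) ε hε
  have e3 := (Metric.tendsto_nhds.1 (hconj _ _ hlr)) ε hε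
  have e4 := (Metric.tendsto_nhds.1 ((hlC.mul hlC).sub hlD)) ε hε
  obtain ⟨m, h1, h2, h3, h4⟩ := (e1.and (e2.and (e3.and e4))).exists
  rw [← hsq, dist_comm] at h2
  rw [dist_comm] at h3
  rw [← hsq, sub_self] at h4
  simp only [dist_eq_norm, sub_zero] at h1 h2 h3 h4
  have hY₀ := conj_mem_unitary hC₀ hY
  have hroot' : P (φ m) (V (φ m) * diagonal (r m) * (V (φ m))ᴴ) := by
    refine hroot _ _ (mul_diagonal_mul_mem_unitary (hV _) (hrn m)) ?_
    rw [mul_diagonal_mul_mul_self (hV _)]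
    simp only [hrr]
    exact (hDV _).symm
  have hPY : P (φ m) (Y * C₀ * Yᴴ) := by
    refine hP _ _ hY₀ _ (mul_diagonal_mul_mem_unitary (hV _) (hrn m)) hroot' ?_ ?_
    · rw [hconjY]; exact h3
    · rw [conj_mul_self_of_commute hY hcomm]; exact h2
  have hP₀ : P (φ m) C₀ := prop_of_prop_conj hC₀ hY hcomm hε
    (fun A hA B hB hAA hPB hAB => hP _ A hA B hB hPB hAB (by rw [hAA]; exact h2)) hPY
  exact hnot _ (hP _ _ (hC _) _ hC₀ hP₀ h1 h4)

/-- Near-roots of a unitary matrix are joined to roots by chains of near-roots, with a closeness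
independent of the size of the matrix. -/
lemma prop_of_near_root {C D : Matrix n n ℂ} (hC : C ∈ unitary (Matrix n n ℂ))
    (hD : D ∈ unitary (Matrix n n ℂ)) {ε δ : ℝ} (hε : 0 < ε) (hCD : ‖C * C - D‖ < δ / 4)
    {P : Matrix n n ℂ → Prop}
    (hP : ∀ A ∈ unitary (Matrix n n ℂ), ∀ B ∈ unitary (Matrix n n ℂ), P B → ‖A - B‖ < ε →
      ‖A * A - D‖ < δ → P A)
    (hroot : ∀ A ∈ unitary (Matrix n n ℂ), A * A = D → P A) : P C := by
  have hδ : 0 < δ := by linarith [norm_nonneg (C * C - D)]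
  obtain ⟨η, hη, hchain⟩ := exists_chain_to_root n (ε := min ε (δ / 4)) (by positivity)
  have hCC : C * C ∈ unitary (Matrix n n ℂ) := mul_mem hC hC
  set W : Matrix n n ℂ := star (C * C) * D with hW
  have hWu : W ∈ unitary (Matrix n n ℂ) := mul_mem (Unitary.star_mem hCC) hD
  have hWD : C * C * W = D := by
    rw [hW, ← mul_assoc, Unitary.mul_star_self_of_mem hCC, one_mul]
  have hW1 : ‖W - 1‖ < δ / 4 := by
    rw [← norm_unitary_mul hCC, mul_sub, mul_one, hWD, norm_sub_rev]; exact hCD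
  obtain ⟨M, hM⟩ := exists_nat_gt (Real.pi / η)
  have hM0 : (0 : ℝ) < M := lt_of_le_of_lt (by positivity) hM
  have key : ∀ k : ℕ, k ≤ M → ∀ A ∈ unitary (Matrix n n ℂ),
      A * A = C * C * unitaryPow W (1 - k / M) → P A := by
    intro k
    induction k with
    | zero =>
      intro _ A hA hAA
      refine hroot A hA ?_
      rw [hAA, Nat.cast_zero, zero_div, sub_zero, unitaryPow_one hWu, hWD]
    | succ k ih =>
      intro hk A hA hAA
      have hZ := unitaryPow_mem hWu (1 - (k + 1 : ℕ) / M)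
      have hZ' := unitaryPow_mem hWu (1 - k / M)
      have hS := unitaryPow_mem hWu (1 / M)
      have h1 : unitaryPow W (1 - k / M) =
          unitaryPow W (1 - (k + 1 : ℕ) / M) * unitaryPow W (1 / M) := by
        rw [← unitaryPow_add]
        congr 1
        push_cast
        field_simp
        ring
      refine hchain A hA (C * C * unitaryPow W (1 - k / M)) (mul_mem hCC hZ') ?_ P ?_
        (ih (by omega))
      · rw [hAA, ← mul_sub, norm_unitary_mul hCC, h1]
        have : ∀ Z S : Matrix n n ℂ, Z - Z * S = Z * (1 - S) := fun Z S => by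
          rw [mul_sub, mul_one]
        rw [this, norm_unitary_mul hZ, norm_sub_rev]
        refine (norm_unitaryPow_sub_one_le hWu (1 / M)).trans_lt ?_
        rw [abs_of_pos (by positivity), mul_one_div, div_lt_iff₀ hM0]
        rw [div_lt_iff₀ hη] at hM
        linarith
      · intro A' hA' B hB hPB hAB hAD
        refine hP A' hA' B hB hPB (hAB.trans_le (min_le_left _ _)) ?_
        have ht : |(1 - k / M : ℝ)| ≤ 1 := by
          have : (k : ℝ) / M ≤ 1 := by
            rw [div_le_one hM0]; exact_mod_cast (by omega : k ≤ M)
          have h0 : 0 ≤ (k : ℝ) / M := by positivity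
          rw [abs_le]; constructor <;> linarith
        have h2 := norm_unitaryPow_sub_one_le_two_mul hWu ht
        have h3 : ‖C * C * unitaryPow W (1 - k / M) - C * C‖ < δ / 2 := by
          have : C * C * unitaryPow W (1 - k / M) - C * C =
              C * C * (unitaryPow W (1 - k / M) - 1) := by rw [mul_sub, mul_one]
          rw [this, norm_unitary_mul hCC]
          linarith
        have h4 := hAD.trans_le (min_le_right _ _)
        calc ‖A' * A' - D‖ = ‖(A' * A' - C * C * unitaryPow W (1 - k / M)) +
              (C * C * unitaryPow W (1 - k / M) - C * C) + (C * C - D)‖ := by congr 1; abel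
          _ ≤ _ := norm_add₃_le
          _ < δ := by linarith
  refine key M le_rfl C hC ?_
  rw [div_self hM0.ne', sub_self, unitaryPow_zero hWu, mul_one]

end RootChains

section Telescoping

variable {ι : Type} [Fintype ι] [DecidableEq ι] {k : ℕ}

/-- A tuple that becomes `b`-close to a flat tuple after adding a tuple that is itself `a`-close to
a flat tuple. -/
def IsFlatComplemented (a b : ℝ) (u : Fin k → Matrix ι ι ℂ) : Prop :=
  ∃ (κ : Type) (_ : Fintype κ) (_ : DecidableEq κ) (x θ : Fin k → Matrix κ κ ℂ)
    (π : Fin k → Matrix (ι ⊕ κ) (ι ⊕ κ) ℂ), IsFlat θ ∧ IsFlat π ∧ (∀ i, ‖x i - θ i‖ ≤ a) ∧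
    ∀ i, ‖dsum (u i) (x i) - π i‖ ≤ b

lemma IsFlat.isFlatComplemented {a b : ℝ} (ha : 0 ≤ a) (hb : 0 ≤ b) {u : Fin k → Matrix ι ι ℂ}
    (hu : IsFlat u) : IsFlatComplemented a b u := by
  have h1 : IsFlat fun _ : Fin k => (1 : Matrix Empty Empty ℂ) := isFlat_one
  refine ⟨Empty, inferInstance, inferInstance, fun _ => 1, fun _ => 1, _, h1, hu.dsum h1, ?_, ?_⟩
    <;> simp [ha, hb]

/-- Regrouping of the four summands in a telescoping step. -/
def regroupEquiv (ι κ₀ κ₁ : Type) : ι ⊕ ((ι ⊕ κ₀) ⊕ κ₁) ≃ (ι ⊕ κ₀) ⊕ (ι ⊕ κ₁) where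
  toFun := Sum.elim (fun i => .inl (.inl i))
    (Sum.elim (Sum.elim (fun i => .inr (.inl i)) fun j => .inl (.inr j)) fun j => .inr (.inr j))
  invFun := Sum.elim (Sum.elim (fun i => .inl i) fun j => .inr (.inl (.inr j)))
    (Sum.elim (fun i => .inr (.inl (.inl i))) fun j => .inr (.inr j))
  left_inv := by rintro (_ | ((_ | _) | _)) <;> rfl
  right_inv := by rintro ((_ | _) | (_ | _)) <;> rfl

lemma reindexHom_regroupEquiv_dsum {κ₀ κ₁ : Type} [Fintype κ₀] [DecidableEq κ₀] [Fintype κ₁]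
    [DecidableEq κ₁] (A B : Matrix ι ι ℂ) (X : Matrix κ₀ κ₀ ℂ) (Y : Matrix κ₁ κ₁ ℂ) :
    reindexHom (regroupEquiv ι κ₀ κ₁) (dsum (dsum A X) (dsum B Y)) =
      dsum A (dsum (dsum B X) Y) := by
  ext (i | ((i | i) | i)) (j | ((j | j) | j)) <;> rfl

lemma IsFlatComplemented.of_near {κ₀ : Type} [Fintype κ₀] [DecidableEq κ₀] {a b c e : ℝ}
    (ha : c + e ≤ a) (hb : c ≤ b) {u u' : Fin k → Matrix ι ι ℂ}
    (h : IsFlatComplemented a b u') (hu : ∀ i, ‖u i - u' i‖ ≤ e)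
    {v : Fin k → Matrix κ₀ κ₀ ℂ} {Q : Fin k → Matrix (ι ⊕ κ₀) (ι ⊕ κ₀) ℂ} (hQ : IsFlat Q)
    (hv : ∀ i, ‖dsum (u i) (v i) - Q i‖ ≤ c) : IsFlatComplemented a b u := by
  obtain ⟨κ₁, _, _, x, θ, π, hθ, hπ, hx, hd⟩ := h
  refine ⟨(ι ⊕ κ₀) ⊕ κ₁, inferInstance, inferInstance, fun i => dsum (dsum (u' i) (v i)) (x i),
    _, _, hQ.dsum hθ, (hQ.dsum hπ).map_reindexHom (regroupEquiv ι κ₀ κ₁), fun i => ?_,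
    fun i => ?_⟩
  · rw [dsum_sub, norm_dsum]
    refine max_le ?_ (hx i)
    have h1 : ‖dsum (u' i) (v i) - dsum (u i) (v i)‖ ≤ e := by
      rw [dsum_sub, norm_dsum, sub_self, norm_zero, max_eq_left (norm_nonneg _), norm_sub_rev]
      exact hu i
    linarith [norm_sub_le_norm_sub_add_norm_sub (dsum (u' i) (v i)) (dsum (u i) (v i)) (Q i), hv i]
  · rw [← reindexHom_regroupEquiv_dsum, ← map_sub, norm_reindexHom, dsum_sub, norm_dsum]
    exact max_le ((hv i).trans hb) (hd i)

theorem exists_isFlatComplemented (k : ℕ) {ε : ℝ} (hε : 0 < ε) :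
    ∃ δ > 0, ∀ (n : Type) [Fintype n] [DecidableEq n] (u : Fin (k + 2) → Matrix n n ℂ),
      (∀ i, u i ∈ unitary (Matrix n n ℂ)) → ‖sqProd u - 1‖ < δ → IsFlatComplemented ε ε u := by
  obtain ⟨δ, hδ, hc⟩ := exists_complement_of_norm_sqProd_sub_one_le k (half_pos hε)
  refine ⟨δ / 4, by positivity, fun n _ _ u hu hs => ?_⟩
  set t : Fin (k + 1) → Matrix n n ℂ := fun i => u i.succ
  have ht : ∀ i, t i ∈ unitary (Matrix n n ℂ) := fun i => hu _
  have hw : sqProd t ∈ unitary (Matrix n n ℂ) := sqProd_mem_unitary ht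
  have hcons (A : Matrix n n ℂ) : sqProd (Fin.cons A t : Fin (k + 2) → Matrix n n ℂ) =
    A * A * sqProd t := sqProd_succ _
  have hu0 : (Fin.cons (u 0) t : Fin (k + 2) → Matrix n n ℂ) = u := Fin.cons_self_tail u
  have hD (A : Matrix n n ℂ) : ‖A * A - star (sqProd t)‖ =
      ‖sqProd (Fin.cons A t : Fin (k + 2) → Matrix n n ℂ) - 1‖ := by
    rw [← norm_mul_unitary hw, sub_mul, Unitary.star_mul_self_of_mem hw, hcons]
  have hcu {A : Matrix n n ℂ} (hA : A ∈ unitary (Matrix n n ℂ)) :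
      ∀ i, (Fin.cons A t : Fin (k + 2) → Matrix n n ℂ) i ∈ unitary (Matrix n n ℂ) :=
    Fin.cases hA ht
  rw [← hu0]
  refine prop_of_near_root (hu 0) (Unitary.star_mem hw) (half_pos hε) (δ := δ)
    (P := fun A => IsFlatComplemented ε ε (Fin.cons A t : Fin (k + 2) → Matrix n n ℂ)) ?_ ?_ ?_
  · rw [hD, hu0]; exact hs
  · intro A hA B hB hPB hAB hAD
    rw [hD] at hAD
    obtain ⟨κ, _, _, v, Q, hQ, hv⟩ := hc n _ (hcu hA) hAD.le
    refine hPB.of_near (e := ε / 2) (by linarith) (by linarith) ?_ hQ hv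
    refine Fin.cases hAB.le fun i => ?_
    simp only [Fin.cons_succ, sub_self, norm_zero]
    positivity
  · intro A hA hAA
    refine IsFlat.isFlatComplemented hε.le hε.le ⟨hcu hA, ?_⟩
    rw [hcons, hAA, Unitary.star_mul_self_of_mem hw]

end Telescoping

section Representations

set_option linter.unusedSectionVars false

variable {m n : Type*} [Fintype m] [DecidableEq m] [Fintype n] [DecidableEq n]

lemma norm_list_prod_le_one (L : List (Matrix n n ℂ)) (h : ∀ A ∈ L, ‖A‖ ≤ 1) : ‖L.prod‖ ≤ 1 := by
  induction L with
  | nil => simpa using norm_one_le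
  | cons A L ih =>
    rw [List.forall_mem_cons] at h
    rw [List.prod_cons]
    exact (norm_mul_le _ _).trans (mul_le_one₀ h.1 (norm_nonneg _) (ih h.2))

lemma norm_mul_sub_mul_le {A A' B B' : Matrix n n ℂ} (hA : ‖A‖ ≤ 1) (hB : ‖B'‖ ≤ 1) :
    ‖A * B - A' * B'‖ ≤ ‖A - A'‖ + ‖B - B'‖ := by
  have h : A * B - A' * B' = A * (B - B') + (A - A') * B' := by noncomm_ring
  have h1 : ‖A * (B - B')‖ ≤ ‖B - B'‖ :=
    (norm_mul_le _ _).trans (mul_le_of_le_one_left (norm_nonneg _) hA)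
  have h2 : ‖(A - A') * B'‖ ≤ ‖A - A'‖ :=
    (norm_mul_le _ _).trans (mul_le_of_le_one_right (norm_nonneg _) hB)
  rw [h]
  linarith [norm_add_le (A * (B - B')) ((A - A') * B')]

lemma norm_map_prod_sub_map_prod_le {α : Type*} {f f' : α → Matrix n n ℂ} {e : ℝ} (L : List α)
    (hf : ∀ x ∈ L, ‖f x‖ ≤ 1) (hf' : ∀ x ∈ L, ‖f' x‖ ≤ 1) (h : ∀ x ∈ L, ‖f x - f' x‖ ≤ e) :
    ‖(L.map f).prod - (L.map f').prod‖ ≤ L.length * e := by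
  induction L with
  | nil => simp
  | cons a L ih =>
    rw [List.forall_mem_cons] at hf hf' h
    simp only [List.map_cons, List.prod_cons, List.length_cons]
    refine (norm_mul_sub_mul_le hf.1 (norm_list_prod_le_one _ ?_)).trans ?_
    · simpa using hf'.2
    · have := ih hf.2 hf'.2 h.2
      push_cast
      linarith [h.1]

lemma norm_apply_prod_sub_map_prod_le {Γ : Type*} [Group Γ] {T : Set Γ} {δ : ℝ}
    {ψ : Γ → Matrix n n ℂ} (h1 : ψ 1 = 1) (hψ : ∀ x, ‖ψ x‖ ≤ 1)
    (hT : ∀ s ∈ T, ∀ t ∈ T, ‖ψ s * ψ t - ψ (s * t)‖ ≤ δ) (L : List Γ) (hL : ∀ x ∈ L, x ∈ T)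
    (hL' : ∀ L' ∈ L.tails, L'.prod ∈ T) :
    ‖ψ L.prod - (L.map ψ).prod‖ ≤ L.length * δ := by
  induction L with
  | nil => simp [h1]
  | cons a L ih =>
    rw [List.forall_mem_cons] at hL
    rw [List.tails, List.forall_mem_cons] at hL'
    have ih := ih hL.2 hL'.2
    have h2 := hT a hL.1 L.prod (hL'.2 L (by simp))
    have h3 : ‖ψ a * ψ L.prod - ψ a * (L.map ψ).prod‖ ≤ ‖ψ L.prod - (L.map ψ).prod‖ := by
      rw [← mul_sub]
      exact (norm_mul_le _ _).trans (mul_le_of_le_one_left (norm_nonneg _) (hψ a))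
    have h4 := norm_sub_le_norm_sub_add_norm_sub (ψ (a * L.prod)) (ψ a * ψ L.prod)
      (ψ a * (L.map ψ).prod)
    rw [norm_sub_rev (ψ (a * L.prod)) (ψ a * ψ L.prod)] at h4
    simp only [List.map_cons, List.prod_cons, List.length_cons]
    push_cast
    linarith

lemma exists_unitary_near {A : Matrix n n ℂ} {δ : ℝ} (hδ : δ < 1) (h : ‖Aᴴ * A - 1‖ ≤ δ) :
    ∃ U ∈ unitary (Matrix n n ℂ), ‖A - U‖ ≤ δ := by
  obtain ⟨V, hV, μ, hμ⟩ := exists_hermitian_diagonalization (isHermitian_conjTranspose_mul_self A)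
  have hV1 := Unitary.star_mul_self_of_mem hV
  have hV2 := Unitary.mul_star_self_of_mem hV
  rw [star_eq_conjTranspose] at hV1 hV2
  have hVu : Vᴴ ∈ unitary (Matrix n n ℂ) := Unitary.star_mem hV
  have hμ1 (i : n) : |μ i - 1| ≤ δ := by
    have h1 : Aᴴ * A - 1 = V * diagonal (fun i => ((μ i - 1 : ℝ) : ℂ)) * Vᴴ := by
      have : diagonal (fun i => ((μ i - 1 : ℝ) : ℂ)) = diagonal (fun i => (μ i : ℂ)) - 1 := by
        rw [← diagonal_one, diagonal_sub]; simp
      rw [this, mul_sub, sub_mul, ← hμ, mul_one, hV2]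
    rw [h1, norm_mul_unitary hVu, norm_unitary_mul hV, l2_opNorm_diagonal] at h
    have := (norm_le_pi_norm _ i).trans h
    simpa only [Complex.norm_real, Real.norm_eq_abs] using this
  have hpos (i : n) : 0 < μ i := by have := abs_le.1 (hμ1 i); linarith
  have hsq (i : n) : (√(μ i) : ℂ) * √(μ i) = μ i := by
    exact_mod_cast Real.mul_self_sqrt (hpos i).le
  have hne (i : n) : (√(μ i) : ℂ) ≠ 0 := by
    exact_mod_cast (Real.sqrt_pos.2 (hpos i)).ne'
  set E : Matrix n n ℂ := diagonal fun i => (√(μ i) : ℂ) with hE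
  set E' : Matrix n n ℂ := diagonal fun i => (√(μ i) : ℂ)⁻¹ with hE'
  have hE's : E'ᴴ = E' := by
    rw [hE', diagonal_conjTranspose]; congr 1; ext i; simp
  have hEE : E' * E = 1 := by
    rw [hE, hE', diagonal_mul_diagonal, ← diagonal_one]; congr 1; ext i; simp [hne i]
  have hEμ : E' * diagonal (fun i => (μ i : ℂ)) * E' = 1 := by
    rw [hE', diagonal_mul_diagonal, diagonal_mul_diagonal, ← diagonal_one]
    congr 1; ext i; rw [← hsq i]; field_simp [hne i]
  set U : Matrix n n ℂ := A * (V * E' * Vᴴ) with hUdef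
  have hU : U ∈ unitary (Matrix n n ℂ) := by
    apply mem_unitary_of_conjTranspose_mul
    calc Uᴴ * U = V * E' * Vᴴ * (Aᴴ * A) * V * E' * Vᴴ := by
          simp only [hUdef, conjTranspose_mul, conjTranspose_conjTranspose, hE's,
            Matrix.mul_assoc]
      _ = V * E' * (Vᴴ * V) * diagonal (fun i => (μ i : ℂ)) * (Vᴴ * V) * E' * Vᴴ := by
          rw [hμ]; simp only [Matrix.mul_assoc]
      _ = V * (E' * diagonal (fun i => (μ i : ℂ)) * E') * Vᴴ := by
          rw [hV1, mul_one, mul_one]; simp only [Matrix.mul_assoc]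
      _ = 1 := by rw [hEμ, mul_one, hV2]
  have hA : A - U = U * (V * (E - 1) * Vᴴ) := by
    have : U * (V * E * Vᴴ) = A := by
      calc U * (V * E * Vᴴ) = A * (V * (E' * (Vᴴ * V) * E) * Vᴴ) := by
            simp only [hUdef, Matrix.mul_assoc]
        _ = A := by rw [hV1, mul_one, hEE, mul_one, hV2, mul_one]
    rw [mul_sub V, sub_mul, mul_sub, this, mul_one, hV2, mul_one]
  refine ⟨U, hU, ?_⟩
  rw [hA, norm_unitary_mul hU, norm_mul_unitary hVu, norm_unitary_mul hV, hE, ← diagonal_one,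
    diagonal_sub, l2_opNorm_diagonal]
  refine (pi_norm_le_iff_of_nonneg ((norm_nonneg _).trans h)).2 fun i => ?_
  have h0 := Real.sqrt_nonneg (μ i)
  have h1 : |μ i - 1| = |√(μ i) - 1| * (√(μ i) + 1) := by
    rw [← abs_of_nonneg (by positivity : 0 ≤ √(μ i) + 1), ← abs_mul]
    congr 1
    nlinarith [Real.mul_self_sqrt (hpos i).le]
  have h2 : ‖(√(μ i) : ℂ) - 1‖ = |√(μ i) - 1| := by
    rw [← Complex.ofReal_one, ← Complex.ofReal_sub, Complex.norm_real, Real.norm_eq_abs]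
  rw [h2]
  have := hμ1 i
  nlinarith [abs_nonneg (√(μ i) - 1)]

lemma IsUcpQuasiRep.map_inv {Γ : Type*} [Group Γ] {n : ℕ} {φ : Γ → Matrix (Fin n) (Fin n) ℂ}
    (hφ : IsUcpQuasiRep φ) (h1 : φ 1 = 1) (x : Γ) : φ x⁻¹ = (φ x)ᴴ := by
  classical
  by_cases hx : x = 1
  · simp [hx, h1]
  have key (c : ℂ) : (c • φ x + starRingEnd ℂ c • φ x⁻¹)ᴴ = c • φ x + starRingEnd ℂ c • φ x⁻¹ := by
    have h := (hφ {1, x} fun y => if y = 1 then 1 else c).isHermitian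
    rw [Finset.sum_pair (Ne.symm hx), Finset.sum_pair (Ne.symm hx),
      Finset.sum_pair (Ne.symm hx)] at h
    simp only [if_true, hx, if_false, inv_one, one_mul, mul_one, inv_mul_cancel, h1, map_one,
      one_smul] at h
    have h2 : ((starRingEnd ℂ c * c) • (1 : Matrix (Fin n) (Fin n) ℂ))ᴴ =
        (starRingEnd ℂ c * c) • 1 := by simp [mul_comm]
    rw [IsHermitian, conjTranspose_add, conjTranspose_add, conjTranspose_add, h2,
      conjTranspose_one] at h
    rw [conjTranspose_add]
    linear_combination (norm := module) h
  have k1 := key 1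
  have k2 := key Complex.I
  simp only [map_one, one_smul, Complex.conj_I, conjTranspose_add, conjTranspose_smul,
    Complex.star_def, map_neg, neg_neg] at k1 k2
  have k3 := congrArg (fun M => Complex.I • M) k2
  simp only [smul_add, smul_neg, smul_smul, Complex.I_mul_I, one_smul, neg_smul, neg_neg] at k3
  have k4 : (2 : ℂ) • φ x⁻¹ = (2 : ℂ) • (φ x)ᴴ := by
    rw [two_smul, two_smul]
    linear_combination (norm := module) -k3 - k1
  exact smul_right_injective _ two_ne_zero k4

end Representations

section Representations

lemma exists_hom_of_isFlat {g : ℕ} {κ : Type*} [Fintype κ] [DecidableEq κ]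
    {θ : Fin (g + 1) → Matrix κ κ ℂ} (hθ : IsFlat θ) :
    ∃ Θ : NonorientableSurfaceGroup g →* unitary (Matrix κ κ ℂ),
      ∀ i, (Θ (PresentedGroup.of i) : Matrix κ κ ℂ) = θ i := by
  let f : Fin (g + 1) → unitary (Matrix κ κ ℂ) := fun i => ⟨θ i, hθ.1 i⟩
  have h : ∀ r ∈ ({nonorientableRelator g} : Set (FreeGroup (Fin (g + 1)))),
      FreeGroup.lift f r = 1 := by
    rintro r rfl
    have h1 : FreeGroup.lift f (nonorientableRelator g) = sqProd f := by
      refine (map_sqProd (FreeGroup.lift f) fun i => FreeGroup.of i).trans ?_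
      simp
    have h2 : ((sqProd f : unitary (Matrix κ κ ℂ)) : Matrix κ κ ℂ) = sqProd θ :=
      map_sqProd (unitary (Matrix κ κ ℂ)).subtype f
    rw [h1]
    exact Subtype.ext (h2.trans hθ.2)
  exact ⟨PresentedGroup.toGroup h, fun i => by rw [PresentedGroup.toGroup.of]⟩

/-- The generators of the surface group and their inverses. -/
def surfaceLetters (g : ℕ) : Set (NonorientableSurfaceGroup g) :=
  {x | ∃ i : Fin (g + 1), x = PresentedGroup.of i ∨ x = (PresentedGroup.of i)⁻¹}

lemma surfaceLetters_finite (g : ℕ) : (surfaceLetters g).Finite := by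
  have h : surfaceLetters g = Set.range (fun i : Fin (g + 1) => PresentedGroup.of i) ∪
      Set.range fun i : Fin (g + 1) => (PresentedGroup.of i)⁻¹ := by
    ext x
    simp only [surfaceLetters, Set.mem_ofPred_eq, Set.mem_union, Set.mem_range, exists_or, eq_comm]
  rw [h]
  exact (Set.finite_range _).union (Set.finite_range _)

lemma exists_word (g : ℕ) (x : NonorientableSurfaceGroup g) :
    ∃ L : List (NonorientableSurfaceGroup g), (∀ y ∈ L, y ∈ surfaceLetters g) ∧ L.prod = x := by
  have hx : x ∈ Subgroup.closure (Set.range fun i : Fin (g + 1) =>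
      (PresentedGroup.of i : NonorientableSurfaceGroup g)) := by
    have h := PresentedGroup.closure_range_of ({nonorientableRelator g} : Set (FreeGroup _))
    exact h ▸ Subgroup.mem_top x
  rw [← Subgroup.mem_toSubmonoid, Subgroup.closure_toSubmonoid] at hx
  obtain ⟨L, hL, rfl⟩ := Submonoid.exists_list_of_mem_closure hx
  refine ⟨L, fun y hy => ?_, rfl⟩
  rcases hL y hy with ⟨i, hi⟩ | ⟨i, hi⟩
  · exact ⟨i, Or.inl hi.symm⟩
  · exact ⟨i, Or.inr (inv_eq_iff_eq_inv.1 hi.symm)⟩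

/-- The word `a₁ a₁ a₂ a₂ ⋯` in the generators. -/
def relatorWord (k : ℕ) : List (Fin k) := (List.finRange k).flatMap fun i => [i, i]

lemma prod_map_relatorWord {M : Type*} [Monoid M] {k : ℕ} (f : Fin k → M) :
    ((relatorWord k).map f).prod = sqProd f := by
  have h (L : List (Fin k)) : ((L.flatMap fun i => [i, i]).map f).prod =
      (L.map fun i => f i * f i).prod := by
    induction L with
    | nil => rfl
    | cons i L ih => simp [ih, mul_assoc]
  rw [relatorWord, h, sqProd, List.ofFn_eq_map]

lemma sqProd_of_eq_one (g : ℕ) : (sqProd fun i : Fin (g + 1) =>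
    (PresentedGroup.of i : NonorientableSurfaceGroup g)) = 1 := by
  have h := map_sqProd (PresentedGroup.mk {nonorientableRelator g}) fun i => FreeGroup.of i
  exact h.symm.trans (PresentedGroup.one_of_mem (Set.mem_singleton _))

variable {n : ℕ} {κ : Type} [Fintype κ] [DecidableEq κ]

lemma norm_le_one_of_hom {Γ : Type*} [Group Γ] (Θ : Γ →* unitary (Matrix κ κ ℂ)) (x : Γ) :
    ‖(Θ x : Matrix κ κ ℂ)‖ ≤ 1 := norm_le_one_of_mem_unitary (Θ x).2

/-- A representation on an arbitrary finite index set yields one on `Fin`. -/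
lemma exists_isUnitaryRep {Γ : Type*} [Group Γ] {S : Set Γ} {ε : ℝ}
    {φ : Γ → Matrix (Fin n) (Fin n) ℂ} (Θ : Γ →* unitary (Matrix κ κ ℂ))
    (Ψ : Γ →* unitary (Matrix (Fin n ⊕ κ) (Fin n ⊕ κ) ℂ))
    (h : ∀ s ∈ S, ‖dsum (φ s) (Θ s : Matrix κ κ ℂ) - Ψ s‖ < ε) :
    ∃ (k : ℕ) (θ : Γ → Matrix (Fin k) (Fin k) ℂ) (π : Γ → Matrix (Fin (n + k)) (Fin (n + k)) ℂ),
      IsUnitaryRep θ ∧ IsUnitaryRep π ∧ ∀ s ∈ S, ‖blockSum (φ s) (θ s) - π s‖ < ε := by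
  have e : Fin (Fintype.card κ) ≃ κ := (Fintype.equivFin κ).symm
  let e' : Fin (n + Fintype.card κ) ≃ Fin n ⊕ κ :=
    finSumFinEquiv.symm.trans (Equiv.sumCongr (Equiv.refl _) e)
  refine ⟨Fintype.card κ, fun s => reindexHom e (Θ s), fun s => reindexHom e' (Ψ s),
    ⟨?_, fun x y => ?_, fun x => map_mem_unitary _ (Θ x).2⟩,
    ⟨?_, fun x y => ?_, fun x => map_mem_unitary _ (Ψ x).2⟩, fun s hs => ?_⟩
  · simp
  · simp only [map_mul, Submonoid.coe_mul]
  · simp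
  · simp only [map_mul, Submonoid.coe_mul]
  · have h1 : blockSum (φ s) (reindexHom e (Θ s : Matrix κ κ ℂ)) =
        reindexHom e' (dsum (φ s) (Θ s : Matrix κ κ ℂ)) := by
      have h2 (x y : Fin n ⊕ Fin (Fintype.card κ)) :
          fromBlocks (φ s) 0 0 (reindexHom e (Θ s : Matrix κ κ ℂ)) x y =
          dsum (φ s) (Θ s : Matrix κ κ ℂ) (Equiv.sumCongr (Equiv.refl _) e x)
            (Equiv.sumCongr (Equiv.refl _) e y) := by
        rcases x with x | x <;> rcases y with y | y <;> rfl
      ext i j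
      exact h2 _ _
    rw [h1, ← map_sub, norm_reindexHom]
    exact h s hs

end Representations

section Stability

variable {n : Type*} [Fintype n] [DecidableEq n]

/-- The products of the tails of a word. -/
def tailProds {Γ : Type*} [Monoid Γ] (L : List Γ) : Set Γ := List.prod '' {L' | L' ∈ L.tails}

lemma tailProds_finite {Γ : Type*} [Monoid Γ] (L : List Γ) : (tailProds L).Finite :=
  (List.finite_toSet _).image _

lemma norm_sub_hom_le {Γ : Type*} [Group Γ] {T : Set Γ} {δ e : ℝ} {ψ : Γ → Matrix n n ℂ}
    (h1 : ψ 1 = 1) (hψ : ∀ x, ‖ψ x‖ ≤ 1)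
    (hT : ∀ s ∈ T, ∀ t ∈ T, ‖ψ s * ψ t - ψ (s * t)‖ ≤ δ) (Ψ : Γ →* unitary (Matrix n n ℂ))
    (L : List Γ) (he : ∀ x ∈ L, ‖ψ x - Ψ x‖ ≤ e) (hL : ∀ x ∈ L, x ∈ T) (hL' : tailProds L ⊆ T) :
    ‖ψ L.prod - Ψ L.prod‖ ≤ L.length * (δ + e) := by
  have h2 := norm_apply_prod_sub_map_prod_le h1 hψ hT L hL fun L' h => hL' ⟨L', h, rfl⟩
  have h3 := norm_map_prod_sub_map_prod_le L (f := ψ) (f' := fun x => (Ψ x : Matrix n n ℂ))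
    (fun x _ => hψ x) (fun x _ => norm_le_one_of_mem_unitary (Ψ x).2) he
  have h4 : (Ψ L.prod : Matrix n n ℂ) = (L.map fun x => (Ψ x : Matrix n n ℂ)).prod :=
    map_list_prod ((unitary (Matrix n n ℂ)).subtype.comp Ψ) L
  rw [h4]
  linarith [norm_sub_le_norm_sub_add_norm_sub (ψ L.prod) (L.map ψ).prod
    (L.map fun x => (Ψ x : Matrix n n ℂ)).prod]

/-- The relator of the surface group, as a word in its generators. -/
def surfaceRelator (g : ℕ) : List (NonorientableSurfaceGroup g) :=
  (relatorWord (g + 1)).map PresentedGroup.of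

lemma surfaceRelator_prod (g : ℕ) : (surfaceRelator g).prod = 1 :=
  (prod_map_relatorWord _).trans (sqProd_of_eq_one g)

lemma mem_surfaceLetters_of_mem_surfaceRelator {g : ℕ} {x : NonorientableSurfaceGroup g}
    (hx : x ∈ surfaceRelator g) : x ∈ surfaceLetters g := by
  obtain ⟨i, -, rfl⟩ := List.mem_map.1 hx
  exact ⟨i, Or.inl rfl⟩

/-- A ucp quasi-representation that is sufficiently multiplicative is close on the generators to
a unitary tuple that almost satisfies the relation. -/
lemma exists_unitary_tuple {g : ℕ} {T : Set (NonorientableSurfaceGroup g)} {δ : ℝ} (hδ : δ < 1)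
    (hT : surfaceLetters g ⊆ T) (hT' : tailProds (surfaceRelator g) ⊆ T) {m : ℕ}
    {φ : NonorientableSurfaceGroup g → Matrix (Fin m) (Fin m) ℂ} (hφ : IsQuasiRep T δ φ)
    (hφ' : IsUcpQuasiRep φ) :
    ∃ u : Fin (g + 1) → Matrix (Fin m) (Fin m) ℂ, (∀ i, u i ∈ unitary _) ∧
      (∀ i, ‖φ (PresentedGroup.of i) - u i‖ ≤ δ) ∧
      ‖sqProd u - 1‖ ≤ (surfaceRelator g).length * (2 * δ) := by
  have h (i : Fin (g + 1)) : ∃ U ∈ unitary (Matrix (Fin m) (Fin m) ℂ),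
      ‖φ (PresentedGroup.of i) - U‖ ≤ δ := by
    refine exists_unitary_near hδ ?_
    have := hφ.2.2 _ (hT ⟨i, Or.inr rfl⟩) _ (hT ⟨i, Or.inl rfl⟩)
    rw [inv_mul_cancel, hφ.1, hφ'.map_inv hφ.1] at this
    exact this.le
  choose u hu hu' using h
  refine ⟨u, hu, hu', ?_⟩
  have h1 := norm_apply_prod_sub_map_prod_le hφ.1 hφ.2.1
    (fun s hs t ht => (hφ.2.2 s hs t ht).le) (surfaceRelator g)
    (fun x hx => hT (mem_surfaceLetters_of_mem_surfaceRelator hx)) fun L' h => hT' ⟨L', h, rfl⟩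
  have h2 := norm_map_prod_sub_map_prod_le (relatorWord (g + 1))
    (f := fun i => φ (PresentedGroup.of i)) (fun x _ => hφ.2.1 _)
    (fun x _ => norm_le_one_of_mem_unitary (hu x)) fun x _ => hu' x
  rw [prod_map_relatorWord u] at h2
  rw [surfaceRelator_prod, hφ.1, surfaceRelator, List.map_map, List.length_map] at h1
  rw [surfaceRelator, List.length_map]
  have h3 := norm_sub_le_norm_sub_add_norm_sub 1
    ((relatorWord (g + 1)).map fun i => φ (PresentedGroup.of i)).prod (sqProd u)
  rw [norm_sub_rev]
  refine h3.trans ?_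
  have := add_le_add h1 h2
  refine this.trans (le_of_eq ?_)
  ring

/-- Closeness on the generators passes to their inverses. -/
lemma norm_sub_le_of_mem_surfaceLetters {g : ℕ} {e : ℝ}
    {ψ : NonorientableSurfaceGroup g → Matrix n n ℂ} (hψ : ∀ x, ψ x⁻¹ = (ψ x)ᴴ)
    (Ψ : NonorientableSurfaceGroup g →* unitary (Matrix n n ℂ))
    (h : ∀ i, ‖ψ (PresentedGroup.of i) - Ψ (PresentedGroup.of i)‖ ≤ e)
    {x : NonorientableSurfaceGroup g} (hx : x ∈ surfaceLetters g) : ‖ψ x - Ψ x‖ ≤ e := by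
  obtain ⟨i, rfl | rfl⟩ := hx
  · exact h i
  · have h1 : (Ψ (PresentedGroup.of i)⁻¹ : Matrix n n ℂ) =
        (Ψ (PresentedGroup.of i) : Matrix n n ℂ)ᴴ := by
      rw [map_inv]; rfl
    rw [hψ, h1, norm_sub_conjTranspose]
    exact h i

end Stability

end

/-- The fundamental group of the closed non-orientable surface of genus
`g` is weakly ucp stable. -/
theorem statement13 (g : ℕ) (hg : 1 ≤ g)
    (S : Set (NonorientableSurfaceGroup g)) (hS : S.Finite) (ε : ℝ) (hε : 0 < ε) :
    ∃ (T : Set (NonorientableSurfaceGroup g)) (δ : ℝ), T.Finite ∧ 0 < δ ∧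
      ∀ (n : ℕ), 1 ≤ n → ∀ φ : NonorientableSurfaceGroup g → Matrix (Fin n) (Fin n) ℂ,
        IsQuasiRep T δ φ → IsUcpQuasiRep φ →
        ∃ (k : ℕ) (θ : NonorientableSurfaceGroup g → Matrix (Fin k) (Fin k) ℂ)
          (π : NonorientableSurfaceGroup g → Matrix (Fin (n + k)) (Fin (n + k)) ℂ),
          IsUnitaryRep θ ∧ IsUnitaryRep π ∧
          ∀ s ∈ S, ‖blockSum (φ s) (θ s) - π s‖ < ε := by
  obtain ⟨k, rfl⟩ : ∃ k, g = k + 1 := ⟨g - 1, by omega⟩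
  choose w hw hw' using exists_word (k + 1)
  obtain ⟨N, hN⟩ := (hS.image fun s => (w s).length).bddAbove
  replace hN : ∀ s ∈ S, (w s).length ≤ N := fun s hs => hN ⟨s, hs, rfl⟩
  set ε₁ : ℝ := ε / (4 * (N + 1)) with hε₁
  have hε₁0 : 0 < ε₁ := by positivity
  obtain ⟨δ₁, hδ₁, H⟩ := exists_isFlatComplemented k hε₁0
  set l : ℝ := ((surfaceRelator (k + 1)).length : ℝ) with hl
  have hl0 : 0 ≤ l := Nat.cast_nonneg _
  set δ : ℝ := min (min (ε₁ / 2) (1 / 2)) (δ₁ / (2 * l + 1)) with hδ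
  have hδ0 : 0 < δ := by positivity
  have hδε : δ ≤ ε₁ / 2 := (min_le_left _ _).trans (min_le_left _ _)
  have hδ1 : δ < 1 := by
    have : δ ≤ 1 / 2 := (min_le_left _ _).trans (min_le_right _ _)
    linarith
  have hδl : l * (2 * δ) < δ₁ := by
    have h : δ * (2 * l + 1) ≤ δ₁ := (le_div_iff₀ (by positivity)).1 (min_le_right _ _)
    linarith
  refine ⟨surfaceLetters (k + 1) ∪ (tailProds (surfaceRelator (k + 1)) ∪
    ⋃ s ∈ S, tailProds (w s)), δ, (surfaceLetters_finite _).union ((tailProds_finite _).union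
    (hS.biUnion fun s _ => tailProds_finite _)), hδ0, fun n _ φ hφ hφ' => ?_⟩
  set T := surfaceLetters (k + 1) ∪ (tailProds (surfaceRelator (k + 1)) ∪
    ⋃ s ∈ S, tailProds (w s)) with hTdef
  have hT : surfaceLetters (k + 1) ⊆ T := Set.subset_union_left
  have hT' : tailProds (surfaceRelator (k + 1)) ⊆ T :=
    Set.subset_union_left.trans Set.subset_union_right
  have hTS (s) (hs : s ∈ S) : tailProds (w s) ⊆ T :=
    (Set.subset_biUnion_of_mem (u := fun s => tailProds (w s)) hs).trans
      (Set.subset_union_right.trans Set.subset_union_right)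
  obtain ⟨u, hu, hφu, hur⟩ := exists_unitary_tuple hδ1 hT hT' hφ hφ'
  obtain ⟨κ, _, _, x, θ, π, hθ, hπ, hxθ, hπu⟩ := H (Fin n) u hu (hur.trans_lt hδl)
  obtain ⟨Θ, hΘ⟩ := exists_hom_of_isFlat hθ
  obtain ⟨Ψ, hΨ⟩ := exists_hom_of_isFlat hπ
  refine exists_isUnitaryRep Θ Ψ fun s hs => ?_
  set ψ := fun s => dsum (φ s) (Θ s : Matrix κ κ ℂ) with hψ
  have h1 : ψ 1 = 1 := by simp only [hψ, hφ.1, map_one, OneMemClass.coe_one, dsum_one]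
  have h2 (y) : ‖ψ y‖ ≤ 1 := by
    rw [hψ, norm_dsum]
    exact max_le (hφ.2.1 y) (norm_le_one_of_hom Θ y)
  have h3 (s) (hs : s ∈ T) (t) (ht : t ∈ T) : ‖ψ s * ψ t - ψ (s * t)‖ ≤ δ := by
    simp only [hψ, dsum_mul, dsum_sub, norm_dsum, map_mul, Submonoid.coe_mul, sub_self, norm_zero]
    exact max_le (hφ.2.2 s hs t ht).le hδ0.le
  have h4 (y) : ψ y⁻¹ = (ψ y).conjTranspose := by
    simp only [hψ, conjTranspose_dsum, hφ'.map_inv hφ.1, map_inv]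
    rfl
  have h5 (i) : ‖ψ (PresentedGroup.of i) - Ψ (PresentedGroup.of i)‖ ≤ 2 * ε₁ + δ := by
    have h : ‖ψ (PresentedGroup.of i) - dsum (u i) (x i)‖ ≤ δ + ε₁ := by
      rw [hψ, dsum_sub, norm_dsum, hΘ, norm_sub_rev (θ i)]
      exact max_le (by linarith [hφu i]) (by linarith [hxθ i])
    rw [hΨ]
    linarith [hπu i, norm_sub_le_norm_sub_add_norm_sub (ψ (PresentedGroup.of i))
      (dsum (u i) (x i)) (π i)]
  have h6 := norm_sub_hom_le h1 h2 h3 Ψ (w s)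
    (fun y hy => norm_sub_le_of_mem_surfaceLetters h4 Ψ h5 (hw s y hy))
    (fun y hy => hT (hw s y hy)) (hTS s hs)
  rw [hw'] at h6
  have h7 : ((w s).length : ℝ) ≤ N := by exact_mod_cast hN s hs
  calc _ ≤ ((w s).length : ℝ) * (δ + (2 * ε₁ + δ)) := h6
    _ ≤ N * (3 * ε₁) := by gcongr; linarith
    _ < (4 * (N + 1)) * ε₁ := by nlinarith [(Nat.cast_nonneg N : (0 : ℝ) ≤ N)]
    _ = ε := by rw [hε₁]; field_simp

end
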